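/- arXiv:1409.0564 — 3 statements merged into one kernel-verified Lean document; each statement's English description precedes it below -/
import Mathlib

section
/- Let p, q, r be nonzero real numbers and fix n ≥ 2. The map (A,B,C) ↦ Tr[A^{q/2} B^p A^{q/2} C^r] on triples of n×n positive definite complex matrices is never jointly concave: there exist positive definite triples (A₁,B₁,C₁), (A₂,B₂,C₂) and λ ∈ [0,1] for which the concavity inequality fails. -/
open Matrix
open scoped ComplexOrder

/-- Real power of a matrix, defined via the spectral decomposition when the matrix is
Hermitian (junk value `0` otherwise). For a positive (semi-)definite matrix this is the
usual real power given by the spectral functional calculus (with `0 ^ r = 0`). -/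
noncomputable def mpow {n : ℕ} (A : Matrix (Fin n) (Fin n) ℂ) (r : ℝ) :
    Matrix (Fin n) (Fin n) ℂ :=
  if h : A.IsHermitian then
    (h.eigenvectorUnitary : Matrix (Fin n) (Fin n) ℂ) *
      Matrix.diagonal (fun i => ((h.eigenvalues i ^ r : ℝ) : ℂ)) *
      (star h.eigenvectorUnitary : Matrix (Fin n) (Fin n) ℂ)
  else 0

/-- `Tr[A^{q/2} B^p A^{q/2} C^r]` (as a real number). -/
noncomputable def trTriple {n : ℕ} (p q r : ℝ) (A B C : Matrix (Fin n) (Fin n) ℂ) : ℝ :=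
  (Matrix.trace (mpow A (q / 2) * mpow B p * mpow A (q / 2) * mpow C r)).re

/-- Joint convexity of a real-valued function of three positive definite matrices. -/
def JointlyConvex3 {n : ℕ}
    (f : Matrix (Fin n) (Fin n) ℂ → Matrix (Fin n) (Fin n) ℂ → Matrix (Fin n) (Fin n) ℂ → ℝ) :
    Prop :=
  ∀ A₁ A₂ B₁ B₂ C₁ C₂ : Matrix (Fin n) (Fin n) ℂ,
    A₁.PosDef → A₂.PosDef → B₁.PosDef → B₂.PosDef → C₁.PosDef → C₂.PosDef →
    ∀ t : ℝ, 0 ≤ t → t ≤ 1 →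
      f (t • A₁ + (1 - t) • A₂) (t • B₁ + (1 - t) • B₂) (t • C₁ + (1 - t) • C₂) ≤
        t * f A₁ B₁ C₁ + (1 - t) * f A₂ B₂ C₂

/-- Joint concavity of a real-valued function of three positive definite matrices. -/
def JointlyConcave3 {n : ℕ}
    (f : Matrix (Fin n) (Fin n) ℂ → Matrix (Fin n) (Fin n) ℂ → Matrix (Fin n) (Fin n) ℂ → ℝ) :
    Prop :=
  ∀ A₁ A₂ B₁ B₂ C₁ C₂ : Matrix (Fin n) (Fin n) ℂ,
    A₁.PosDef → A₂.PosDef → B₁.PosDef → B₂.PosDef → C₁.PosDef → C₂.PosDef →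
    ∀ t : ℝ, 0 ≤ t → t ≤ 1 →
      t * f A₁ B₁ C₁ + (1 - t) * f A₂ B₂ C₂ ≤
        f (t • A₁ + (1 - t) • A₂) (t • B₁ + (1 - t) • B₂) (t • C₁ + (1 - t) • C₂)

/-- Real powers act on an eigenvector by the corresponding power of the eigenvalue. -/
lemma mpow_mulVec_of_eigenvector {n : ℕ} {A : Matrix (Fin n) (Fin n) ℂ} (hA : A.IsHermitian)
    {v : Fin n → ℂ} {d : ℝ} (hv : A *ᵥ v = (d : ℂ) • v) (s : ℝ) :
    mpow A s *ᵥ v = ((d ^ s : ℝ) : ℂ) • v := by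
  set U : Matrix (Fin n) (Fin n) ℂ := ↑hA.eigenvectorUnitary
  have hUU : star U * U = 1 := Unitary.coe_star_mul_self hA.eigenvectorUnitary
  have hUU' : U * star U = 1 := Unitary.coe_mul_star_self hA.eigenvectorUnitary
  have hspec : A = U * diagonal (fun i => (hA.eigenvalues i : ℂ)) * star U := hA.spectral_theorem
  have hw : diagonal (fun i => (hA.eigenvalues i : ℂ)) *ᵥ (star U *ᵥ v) =
      (d : ℂ) • (star U *ᵥ v) := by
    rw [← mulVec_smul, ← hv]
    conv_rhs => rw [hspec]
    simp only [mulVec_mulVec, ← Matrix.mul_assoc, hUU, Matrix.one_mul]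
  have hw' : diagonal (fun i => ((hA.eigenvalues i ^ s : ℝ) : ℂ)) *ᵥ (star U *ᵥ v) =
      ((d ^ s : ℝ) : ℂ) • (star U *ᵥ v) := by
    ext i
    have h := congrFun hw i
    simp only [mulVec_diagonal, Pi.smul_apply, smul_eq_mul] at h ⊢
    rcases eq_or_ne ((star U *ᵥ v) i) 0 with h0 | h0
    · simp [h0]
    · have hd : hA.eigenvalues i = d := by exact_mod_cast mul_right_cancel₀ h0 h
      rw [hd]
  have hm : mpow A s = U * diagonal (fun i => ((hA.eigenvalues i ^ s : ℝ) : ℂ)) * star U := by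
    rw [mpow, dif_pos hA]
  rw [hm, ← mulVec_mulVec, ← mulVec_mulVec, hw', mulVec_smul, mulVec_mulVec, hUU', one_mulVec]

lemma mpow_isHermitian {n : ℕ} (A : Matrix (Fin n) (Fin n) ℂ) (s : ℝ) :
    (mpow A s).IsHermitian := by
  unfold mpow
  split_ifs with h
  · refine isHermitian_mul_mul_conjTranspose _ (isHermitian_diagonal_iff.2 fun i => ?_)
    simp [isSelfAdjoint_iff]
  · exact isHermitian_zero

lemma mpow_diagonal {n : ℕ} (d : Fin n → ℝ) (s : ℝ) :
    mpow (diagonal fun i => (d i : ℂ)) s = diagonal fun i => ((d i ^ s : ℝ) : ℂ) := by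
  have hD : (diagonal fun i => (d i : ℂ)).IsHermitian :=
    isHermitian_diagonal_iff.2 fun i => by simp [isSelfAdjoint_iff]
  refine Matrix.ext_of_mulVec_single fun i => ?_
  rw [mpow_mulVec_of_eigenvector hD (d := d i)]
  · ext k
    by_cases h : k = i <;> simp [h, mulVec_diagonal]
  · ext k
    by_cases h : k = i <;> simp [h, mulVec_diagonal]

lemma re_trace_mul_diagonal_mul_diagonal {n : ℕ} {M : Matrix (Fin n) (Fin n) ℂ}
    (hM : M.IsHermitian) (b c : Fin n → ℝ) :
    (trace (M * diagonal (fun i => (b i : ℂ)) * M * diagonal (fun i => (c i : ℂ)))).re =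
      ∑ k, ∑ l, b l * c k * ‖M k l‖ ^ 2 := by
  simp only [trace, diag_apply, mul_diagonal]
  simp only [Matrix.mul_apply (N := M), mul_diagonal, Complex.re_sum, Finset.sum_mul]
  refine Finset.sum_congr rfl fun k _ => Finset.sum_congr rfl fun l _ => ?_
  have h : M k l * (b l : ℂ) * M l k * (c k : ℂ) = ((b l * c k * ‖M k l‖ ^ 2 : ℝ) : ℂ) := by
    rw [← hM.apply l k]
    push_cast
    rw [← Complex.mul_conj']
    simp only [RCLike.star_def]
    ring
  rw [h, Complex.ofReal_re]

/-- The off-diagonal entry of a power of a matrix having `eᵢ + eⱼ` and `eᵢ - eⱼ` as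
eigenvectors. -/
lemma mpow_apply_of_eigenvector_add_sub {n : ℕ} {A : Matrix (Fin n) (Fin n) ℂ}
    (hA : A.IsHermitian) {i j : Fin n} (hij : i ≠ j) {x y : ℝ}
    (hx : A *ᵥ (Pi.single i 1 + Pi.single j 1) = (x : ℂ) • (Pi.single i 1 + Pi.single j 1))
    (hy : A *ᵥ (Pi.single i 1 - Pi.single j 1) = (y : ℂ) • (Pi.single i 1 - Pi.single j 1))
    (s : ℝ) : mpow A s j i = (((x ^ s - y ^ s) / 2 : ℝ) : ℂ) := by
  have h₁ := congrFun (mpow_mulVec_of_eigenvector hA hx s) j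
  have h₂ := congrFun (mpow_mulVec_of_eigenvector hA hy s) j
  simp [mulVec_add, mulVec_sub, hij.symm] at h₁ h₂
  push_cast
  linear_combination (h₁ + h₂) / 2

/-- Rank-one perturbations of the identity along `eᵢ + eⱼ` and `eᵢ - eⱼ` average to a diagonal
matrix. -/
lemma exists_diagonal_average_vecMulVec {n : ℕ} {i j : Fin n} (hij : i ≠ j) :
    ∃ d : Fin n → ℝ,
      (1 / 2 : ℝ) • (1 + vecMulVec (Pi.single i 1 + Pi.single j 1 : Fin n → ℂ)
          (star (Pi.single i 1 + Pi.single j 1))) +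
        (1 - 1 / 2 : ℝ) • (1 + vecMulVec (Pi.single i 1 - Pi.single j 1 : Fin n → ℂ)
          (star (Pi.single i 1 - Pi.single j 1))) = diagonal fun k => (d k : ℂ) := by
  refine ⟨fun k => if k = i ∨ k = j then 2 else 1, ?_⟩
  ext k l
  simp only [Matrix.add_apply, Matrix.smul_apply, vecMulVec_apply, diagonal_apply,
    Pi.star_apply, Pi.add_apply, Pi.sub_apply, Matrix.one_apply, Pi.single_apply]
  by_cases h₁ : k = i <;> by_cases h₂ : k = j <;> by_cases h₃ : l = i <;> by_cases h₄ : l = j <;>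
    by_cases h₅ : k = l <;> simp_all [eq_comm] <;> norm_num

/-- Corollary 3.3, concave part: `(A,B,C) ↦ Tr[A^{q/2} B^p A^{q/2} C^r]` is never
jointly concave. -/
theorem trace_triple_never_concave (p q r : ℝ) (hp : p ≠ 0) (hq : q ≠ 0) (hr : r ≠ 0)
    (n : ℕ) (hn : 2 ≤ n) :
    ¬ JointlyConcave3 (trTriple (n := n) p q r) := by
  intro hconc
  obtain ⟨i, j, hij⟩ : ∃ i j : Fin n, i ≠ j := ⟨⟨0, by omega⟩, ⟨1, by omega⟩, by simp⟩
  set v : Fin n → ℂ := Pi.single i 1 + Pi.single j 1 with hv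
  set w : Fin n → ℂ := Pi.single i 1 - Pi.single j 1 with hw
  have hsv : star v ⬝ᵥ v = 2 := by
    simp [hv, hij, hij.symm, dotProduct_add, one_add_one_eq_two]
  have hsw : star w ⬝ᵥ w = 2 := by
    simp [hw, hij, hij.symm, dotProduct_sub, one_add_one_eq_two]
  have hvw : star v ⬝ᵥ w = 0 := by
    simp [hv, hw, hij, hij.symm, dotProduct_sub]
  have hwv : star w ⬝ᵥ v = 0 := by
    simp [hv, hw, hij, hij.symm, dotProduct_add]
  have hP (u : Fin n → ℂ) : (1 + vecMulVec u (star u)).PosDef :=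
    PosDef.one.add_posSemidef (posSemidef_vecMulVec_self_star u)
  have hmv (u z : Fin n → ℂ) :
      (1 + vecMulVec u (star u)) *ᵥ z = z + (star u ⬝ᵥ z) • u := by
    rw [add_mulVec, one_mulVec, vecMulVec_mulVec]
    simp
  obtain ⟨d, hmid⟩ := exists_diagonal_average_vecMulVec hij
  rw [← hv, ← hw] at hmid
  set m : ℝ := ‖((((3 : ℝ) ^ (q / 2) - 1) / 2 : ℝ) : ℂ)‖ ^ 2 with hm
  have hm0 : 0 < m := by
    have h3 : (3 : ℝ) ^ (q / 2) ≠ 1 := by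
      rw [← Real.rpow_zero 3, Ne, Real.rpow_right_inj (by norm_num) (by norm_num)]
      exact div_ne_zero hq two_ne_zero
    have : (((3 : ℝ) ^ (q / 2) - 1) / 2 : ℝ) ≠ 0 := div_ne_zero (sub_ne_zero.2 h3) two_ne_zero
    exact pow_pos (norm_pos_iff.2 (Complex.ofReal_ne_zero.2 this)) 2
  have hmv₁ : ‖mpow (1 + vecMulVec v (star v)) (q / 2) j i‖ ^ 2 = m := by
    rw [mpow_apply_of_eigenvector_add_sub (hP v).1 hij (x := 3) (y := 1), Real.one_rpow]
    · rw [← hv, hmv, hsv]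
      module
    · rw [← hw, hmv, hvw]
      simp
  have hmv₂ : ‖mpow (1 + vecMulVec w (star w)) (q / 2) j i‖ ^ 2 = m := by
    rw [mpow_apply_of_eigenvector_add_sub (hP w).1 hij (x := 1) (y := 3), Real.one_rpow, hm,
      ← norm_neg]
    · congr 2
      push_cast
      ring
    · rw [← hv, hmv, hwv]
      simp
    · rw [← hw, hmv, hsw]
      module
  set K : ℝ := ∑ k, ‖((d k ^ (q / 2) : ℝ) : ℂ)‖ ^ 2 with hK
  have hK0 : 0 ≤ K := Finset.sum_nonneg fun k _ => sq_nonneg _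
  clear_value m K
  obtain ⟨δ, hδ0, hδ1, hδ⟩ : ∃ δ : ℝ, 0 < δ ∧ δ ≤ 1 ∧ δ * K < m := by
    refine ⟨m / (m + K + 1), by positivity, ?_, ?_⟩
    · rw [div_le_one (by positivity)]
      linarith
    · rw [div_mul_eq_mul_div, div_lt_iff₀ (by positivity)]
      nlinarith
  set b : Fin n → ℝ := fun k => if k = i then 1 else δ with hb
  set c : Fin n → ℝ := fun k => if k = j then 1 else δ with hc
  have hb0 (k) : 0 < b k := by simp only [hb]; split_ifs <;> positivity
  have hc0 (k) : 0 < c k := by simp only [hc]; split_ifs <;> positivity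
  have hbc (k) : b k * c k ≤ δ := by
    simp only [hb, hc]
    split_ifs with h₁ h₂
    · exact absurd (h₁.symm.trans h₂) hij
    · simp
    · simp
    · nlinarith
  -- `diagonal x` with `x = y ^ (1 / s)` is positive definite with `s`-th power `diagonal y`.
  have hroot (y : Fin n → ℝ) (hy : ∀ k, 0 < y k) (s : ℝ) (hs : s ≠ 0) :
      ∃ X : Matrix (Fin n) (Fin n) ℂ, X.PosDef ∧ mpow X s = diagonal fun k => (y k : ℂ) := by
    refine ⟨diagonal fun k => ((y k ^ s⁻¹ : ℝ) : ℂ), PosDef.diagonal fun k => ?_, ?_⟩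
    · exact_mod_cast Real.rpow_pos_of_pos (hy k) _
    · rw [mpow_diagonal]
      simp_rw [Real.rpow_inv_rpow (hy _).le hs]
  obtain ⟨B, hB, hBp⟩ := hroot b hb0 p hp
  obtain ⟨C, hC, hCr⟩ := hroot c hc0 r hr
  have htr (A : Matrix (Fin n) (Fin n) ℂ) :
      trTriple p q r A B C = ∑ k, ∑ l, b l * c k * ‖mpow A (q / 2) k l‖ ^ 2 := by
    rw [trTriple, hBp, hCr, re_trace_mul_diagonal_mul_diagonal (mpow_isHermitian A _)]
  have hlow (A : Matrix (Fin n) (Fin n) ℂ) :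
      ‖mpow A (q / 2) j i‖ ^ 2 ≤ trTriple p q r A B C := by
    have h0 (k l) : 0 ≤ b l * c k * ‖mpow A (q / 2) k l‖ ^ 2 :=
      mul_nonneg (mul_pos (hb0 l) (hc0 k)).le (sq_nonneg _)
    rw [htr]
    calc ‖mpow A (q / 2) j i‖ ^ 2 = b i * c j * ‖mpow A (q / 2) j i‖ ^ 2 := by simp [hb, hc]
      _ ≤ ∑ l, b l * c j * ‖mpow A (q / 2) j l‖ ^ 2 :=
        Finset.single_le_sum (f := fun l => b l * c j * ‖mpow A (q / 2) j l‖ ^ 2)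
          (fun l _ => h0 j l) (Finset.mem_univ i)
      _ ≤ _ := Finset.single_le_sum (f := fun k => ∑ l, b l * c k * ‖mpow A (q / 2) k l‖ ^ 2)
          (fun k _ => Finset.sum_nonneg fun l _ => h0 k l) (Finset.mem_univ j)
  have hup : trTriple p q r (diagonal fun k => (d k : ℂ)) B C ≤ δ * K := by
    rw [htr, mpow_diagonal, hK, Finset.mul_sum]
    refine Finset.sum_le_sum fun k _ => ?_
    rw [Finset.sum_eq_single k (fun l _ hl => by simp [diagonal_apply_ne' _ hl]) (by simp),
      diagonal_apply_eq]
    exact mul_le_mul_of_nonneg_right (hbc k) (sq_nonneg _)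
  have hconv := hconc _ _ B B C C (hP v) (hP w) hB hB hC hC (1 / 2) (by norm_num) (by norm_num)
  have hself (X : Matrix (Fin n) (Fin n) ℂ) : (1 / 2 : ℝ) • X + (1 - 1 / 2 : ℝ) • X = X := by
    rw [← add_smul]
    norm_num
  rw [hmid, hself, hself] at hconv
  have h₁ := hlow (1 + vecMulVec v (star v))
  have h₂ := hlow (1 + vecMulVec w (star w))
  rw [hmv₁] at h₁
  rw [hmv₂] at h₂
  linarith
end

section
/- Let p ∈ [1,2], q ∈ [−1,0), and let s be a real number with s ≥ min{1/(p−1), 1/(1+q)} (where 1/(p−1) is interpreted as +∞ when p = 1 and 1/(1+q) as +∞ when q = −1). Then for every n, the trace function Φ_{p,q,s}(A,B) = Tr[(A^{q/2} B^p A^{q/2})^s] is jointly convex on pairs of n×n positive definite complex matrices. -/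
open Matrix
open scoped ComplexOrder

/-- `Ψ_{K,p,q,s}(A,B) = Tr[(A^{q/2} K* B^p K A^{q/2})^s]`. -/
noncomputable def Psi {n : ℕ} (K : Matrix (Fin n) (Fin n) ℂ) (p q s : ℝ)
    (A B : Matrix (Fin n) (Fin n) ℂ) : ℝ :=
  (Matrix.trace (mpow (mpow A (q / 2) * Kᴴ * mpow B p * K * mpow A (q / 2)) s)).re

/-- `Φ_{p,q,s}(A,B) = Tr[(A^{q/2} B^p A^{q/2})^s]`. -/
noncomputable def Phi {n : ℕ} (p q s : ℝ) (A B : Matrix (Fin n) (Fin n) ℂ) : ℝ :=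
  (Matrix.trace (mpow (mpow A (q / 2) * mpow B p * mpow A (q / 2)) s)).re

/-- Joint convexity of a real-valued function of two positive definite matrices. -/
def JointlyConvex {n : ℕ}
    (f : Matrix (Fin n) (Fin n) ℂ → Matrix (Fin n) (Fin n) ℂ → ℝ) : Prop :=
  ∀ A₁ A₂ B₁ B₂ : Matrix (Fin n) (Fin n) ℂ,
    A₁.PosDef → A₂.PosDef → B₁.PosDef → B₂.PosDef →
    ∀ t : ℝ, 0 ≤ t → t ≤ 1 →
      f (t • A₁ + (1 - t) • A₂) (t • B₁ + (1 - t) • B₂) ≤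
        t * f A₁ B₁ + (1 - t) * f A₂ B₂

open MeasureTheory

namespace TraceConvexity

variable {n : ℕ} {A B P Z : Matrix (Fin n) (Fin n) ℂ}

lemma mpow_eq_cfc (hA : A.IsHermitian) (r : ℝ) : mpow A r = cfc (fun x : ℝ => x ^ r) A := by
  rw [hA.cfc_eq, IsHermitian.cfc, Unitary.conjStarAlgAut_apply, mpow, dif_pos hA]
  rfl

lemma spectrum_pos (hA : A.PosDef) {x : ℝ} (hx : x ∈ spectrum ℝ A) : 0 < x := by
  rw [hA.isHermitian.spectrum_real_eq_range_eigenvalues] at hx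
  obtain ⟨i, rfl⟩ := hx
  exact hA.eigenvalues_pos i

lemma continuousOn_spectrum (f : ℝ → ℝ) : ContinuousOn f (spectrum ℝ A) :=
  (Matrix.finite_real_spectrum (A := A)).continuousOn f

lemma posDef_mpow (hA : A.PosDef) (r : ℝ) : (mpow A r).PosDef := by
  rw [mpow, dif_pos hA.isHermitian]
  refine (IsUnit.posDef_star_right_conjugate_iff
    (Unitary.toUnits hA.isHermitian.eigenvectorUnitary).isUnit).2 ?_
  refine Matrix.PosDef.diagonal fun i => ?_
  exact_mod_cast Real.rpow_pos_of_pos (hA.eigenvalues_pos i) r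

lemma mpow_one (hA : A.PosDef) : mpow A 1 = A := by
  have : IsSelfAdjoint A := hA.isHermitian
  simp [mpow_eq_cfc hA.isHermitian, cfc_id' ℝ A]

lemma mpow_zero (hA : A.PosDef) : mpow A 0 = 1 := by
  have : IsSelfAdjoint A := hA.isHermitian
  simp [mpow_eq_cfc hA.isHermitian, cfc_const_one ℝ A]

lemma mpow_mul_mpow (hA : A.PosDef) (r s : ℝ) : mpow A r * mpow A s = mpow A (r + s) := by
  simp only [mpow_eq_cfc hA.isHermitian]
  rw [← cfc_mul _ _ A (continuousOn_spectrum _) (continuousOn_spectrum _)]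
  exact cfc_congr fun x hx => (Real.rpow_add (spectrum_pos hA hx) r s).symm

lemma mpow_mpow (hA : A.PosDef) (r s : ℝ) : mpow (mpow A r) s = mpow A (r * s) := by
  rw [mpow_eq_cfc (posDef_mpow hA r).isHermitian]
  simp only [mpow_eq_cfc hA.isHermitian]
  have : IsSelfAdjoint A := hA.isHermitian
  rw [← cfc_comp' _ _ A ((Matrix.finite_real_spectrum.image _).continuousOn _)
    (continuousOn_spectrum _)]
  exact cfc_congr fun x hx => (Real.rpow_mul (spectrum_pos hA hx).le r s).symm

lemma mpow_half_mul_self (hA : A.PosDef) : mpow A (1 / 2) * mpow A (1 / 2) = A := by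
  rw [mpow_mul_mpow hA, add_halves, mpow_one hA]

lemma mpow_mul_mpow_neg (hA : A.PosDef) (r : ℝ) : mpow A r * mpow A (-r) = 1 := by
  rw [mpow_mul_mpow hA, add_neg_cancel, mpow_zero hA]

lemma mpow_neg_mul_mpow (hA : A.PosDef) (r : ℝ) : mpow A (-r) * mpow A r = 1 := by
  rw [mpow_mul_mpow hA, neg_add_cancel, mpow_zero hA]

lemma mpow_one_matrix (r : ℝ) : mpow (1 : Matrix (Fin n) (Fin n) ℂ) r = 1 := by
  rw [mpow_eq_cfc isHermitian_one]
  simp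

lemma posDef_conj (hA : A.PosDef) (hB : B.PosDef) : (B * A * B).PosDef := by
  have := (IsUnit.posDef_star_right_conjugate_iff (x := A) hB.isUnit).2 hA
  rwa [star_eq_conjTranspose, hB.isHermitian.eq] at this

lemma trace_mpow (hA : A.IsHermitian) (s : ℝ) :
    trace (mpow A s) = (A.charpoly.roots.map fun z : ℂ => ((z.re ^ s : ℝ) : ℂ)).sum := by
  rw [hA.roots_charpoly_eq_eigenvalues, mpow, dif_pos hA, Matrix.trace_mul_cycle,
    Unitary.coe_star_mul_self]
  simp [Matrix.trace_diagonal, List.sum_ofFn]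

lemma trace_mpow_mul_conjTranspose_comm (X : Matrix (Fin n) (Fin n) ℂ) (s : ℝ) :
    trace (mpow (X * Xᴴ) s) = trace (mpow (Xᴴ * X) s) := by
  rw [trace_mpow (isHermitian_mul_conjTranspose_self X),
    trace_mpow (isHermitian_conjTranspose_mul_self X), charpoly_mul_comm]

lemma re_trace_mpow_mul_mpow (hP : P.PosDef) (hZ : Z.PosDef) (K : Matrix (Fin n) (Fin n) ℂ)
    (r u : ℝ) :
    (trace (Kᴴ * mpow P r * K * mpow Z u)).re =
      ∑ i, ∑ j, hP.isHermitian.eigenvalues i ^ r * hZ.isHermitian.eigenvalues j ^ u *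
        Complex.normSq (((hP.isHermitian.eigenvectorUnitary : Matrix (Fin n) (Fin n) ℂ)ᴴ * K *
          (hZ.isHermitian.eigenvectorUnitary : Matrix (Fin n) (Fin n) ℂ)) i j) := by
  set U := (hP.isHermitian.eigenvectorUnitary : Matrix (Fin n) (Fin n) ℂ) with hU
  set V := (hZ.isHermitian.eigenvectorUnitary : Matrix (Fin n) (Fin n) ℂ) with hV
  set L := Uᴴ * K * V with hL
  have key : trace (Kᴴ * mpow P r * K * mpow Z u) =
      trace (Lᴴ * diagonal (fun i => ((hP.isHermitian.eigenvalues i ^ r : ℝ) : ℂ)) * L *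
        diagonal (fun i => ((hZ.isHermitian.eigenvalues i ^ u : ℝ) : ℂ))) := by
    rw [mpow, dif_pos hP.isHermitian, mpow, dif_pos hZ.isHermitian, hL]
    simp only [conjTranspose_mul, conjTranspose_conjTranspose,
      star_eq_conjTranspose, ← hU, ← hV]
    rw [← Matrix.mul_assoc, Matrix.trace_mul_comm]
    simp only [Matrix.mul_assoc]
  rw [key, Matrix.trace, Complex.re_sum, Finset.sum_comm]
  refine Finset.sum_congr rfl fun j _ => ?_
  rw [diag_apply, mul_diagonal, Matrix.mul_apply, Finset.sum_mul, Complex.re_sum]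
  refine Finset.sum_congr rfl fun i _ => ?_
  rw [mul_diagonal, conjTranspose_apply, Complex.star_def]
  rw [mul_right_comm _ _ (L i j), ← Complex.normSq_eq_conj_mul_self, mul_assoc,
    ← Complex.ofReal_mul, ← Complex.ofReal_mul, Complex.ofReal_re]
  ring

lemma young_trace (hP : P.PosDef) (hZ : Z.PosDef) {s : ℝ} (hs : 1 < s) :
    s * (trace (P * Z)).re ≤
      (trace (mpow P s)).re + (s - 1) * (trace (mpow Z (s / (s - 1)))).re := by
  have h1 := re_trace_mpow_mul_mpow hP hZ 1 1 1
  have h2 := re_trace_mpow_mul_mpow hP hZ 1 s 0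
  have h3 := re_trace_mpow_mul_mpow hP hZ 1 0 (s / (s - 1))
  simp only [mpow_one hP, mpow_one hZ, mpow_zero hP, mpow_zero hZ, conjTranspose_one,
    Real.rpow_one, Real.rpow_zero, mul_one, one_mul] at h1 h2 h3
  rw [h1, h2, h3]
  simp only [Finset.mul_sum, ← Finset.sum_add_distrib]
  refine Finset.sum_le_sum fun i _ => Finset.sum_le_sum fun j _ => ?_
  have hs0 : 0 < s := by linarith
  have hy := Real.young_inequality_of_nonneg (hP.eigenvalues_pos i).le (hZ.eigenvalues_pos j).le
    (Real.HolderConjugate.conjExponent hs)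
  rw [Real.conjExponent] at hy
  have hy' := mul_le_mul_of_nonneg_left hy hs0.le
  have : s * (hP.isHermitian.eigenvalues i ^ s / s +
      hZ.isHermitian.eigenvalues j ^ (s / (s - 1)) / (s / (s - 1))) =
      hP.isHermitian.eigenvalues i ^ s +
        (s - 1) * hZ.isHermitian.eigenvalues j ^ (s / (s - 1)) := by
    have : s - 1 ≠ 0 := by linarith
    field_simp
  rw [this] at hy'
  have := mul_le_mul_of_nonneg_right hy' (Complex.normSq_nonneg
    (((hP.isHermitian.eigenvectorUnitary : Matrix (Fin n) (Fin n) ℂ)ᴴ *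
      (hZ.isHermitian.eigenvectorUnitary : Matrix (Fin n) (Fin n) ℂ)) i j))
  linarith

lemma weighted_normSq_ge {a z : ℝ} (ha : 0 < a) (hz : 0 < z) (k x : ℂ) :
    a * z / (a + z) * Complex.normSq k ≤ a * Complex.normSq x + z * Complex.normSq (k - x) := by
  rw [div_mul_eq_mul_div, div_le_iff₀ (by positivity)]
  simp only [Complex.normSq_apply, Complex.sub_re, Complex.sub_im]
  nlinarith [sq_nonneg ((a + z) * x.re - z * k.re), sq_nonneg ((a + z) * x.im - z * k.im)]

lemma weighted_normSq_eq {a z : ℝ} (ha : 0 < a) (hz : 0 < z) (k : ℂ) :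
    a * Complex.normSq (((z / (a + z) : ℝ) : ℂ) * k) +
      z * Complex.normSq (k - ((z / (a + z) : ℝ) : ℂ) * k) =
      a * z / (a + z) * Complex.normSq k := by
  have : k - ((z / (a + z) : ℝ) : ℂ) * k = ((a / (a + z) : ℝ) : ℂ) * k := by
    have h : (a / (a + z) : ℝ) = 1 - z / (a + z) := by field_simp; ring
    rw [h]
    push_cast
    ring
  rw [this, Complex.normSq_mul, Complex.normSq_mul, Complex.normSq_ofReal, Complex.normSq_ofReal]
  field_simp
  ring

/-- The quadratic form at `K` of the parallel sum of left multiplication by `τ • P` and right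
multiplication by `Z`, divided by `τ`. -/
noncomputable def parallelForm (hP : P.PosDef) (hZ : Z.PosDef) (K : Matrix (Fin n) (Fin n) ℂ)
    (τ : ℝ) : ℝ :=
  ∑ i, ∑ j, hP.isHermitian.eigenvalues i * hZ.isHermitian.eigenvalues j /
      (τ * hP.isHermitian.eigenvalues i + hZ.isHermitian.eigenvalues j) *
    Complex.normSq (((hP.isHermitian.eigenvectorUnitary : Matrix (Fin n) (Fin n) ℂ)ᴴ * K *
      (hZ.isHermitian.eigenvectorUnitary : Matrix (Fin n) (Fin n) ℂ)) i j)

lemma re_trace_quadratic_add (hP : P.PosDef) (hZ : Z.PosDef) (X Y : Matrix (Fin n) (Fin n) ℂ)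
    (τ : ℝ) :
    τ * (trace (Xᴴ * P * X)).re + (trace (Yᴴ * Y * Z)).re =
      ∑ i, ∑ j, (τ * hP.isHermitian.eigenvalues i *
        Complex.normSq (((hP.isHermitian.eigenvectorUnitary : Matrix (Fin n) (Fin n) ℂ)ᴴ * X *
          (hZ.isHermitian.eigenvectorUnitary : Matrix (Fin n) (Fin n) ℂ)) i j) +
        hZ.isHermitian.eigenvalues j *
        Complex.normSq (((hP.isHermitian.eigenvectorUnitary : Matrix (Fin n) (Fin n) ℂ)ᴴ * Y *
          (hZ.isHermitian.eigenvectorUnitary : Matrix (Fin n) (Fin n) ℂ)) i j)) := by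
  have h1 := re_trace_mpow_mul_mpow hP hZ X 1 0
  have h2 := re_trace_mpow_mul_mpow hP hZ Y 0 1
  simp only [mpow_one hP, mpow_one hZ, mpow_zero hP, mpow_zero hZ,
    Real.rpow_one, Real.rpow_zero, mul_one, one_mul] at h1 h2
  rw [h1, h2]
  simp only [Finset.mul_sum, ← Finset.sum_add_distrib, mul_assoc]

lemma parallelForm_le (hP : P.PosDef) (hZ : Z.PosDef) (K X : Matrix (Fin n) (Fin n) ℂ)
    {τ : ℝ} (hτ : 0 < τ) :
    τ * parallelForm hP hZ K τ ≤
      τ * (trace (Xᴴ * P * X)).re + (trace ((K - X)ᴴ * (K - X) * Z)).re := by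
  rw [re_trace_quadratic_add hP hZ, parallelForm]
  simp only [Finset.mul_sum]
  refine Finset.sum_le_sum fun i _ => Finset.sum_le_sum fun j _ => ?_
  have := weighted_normSq_ge (mul_pos hτ (hP.eigenvalues_pos i)) (hZ.eigenvalues_pos j)
    (((hP.isHermitian.eigenvectorUnitary : Matrix (Fin n) (Fin n) ℂ)ᴴ * K *
      (hZ.isHermitian.eigenvectorUnitary : Matrix (Fin n) (Fin n) ℂ)) i j)
    (((hP.isHermitian.eigenvectorUnitary : Matrix (Fin n) (Fin n) ℂ)ᴴ * X *
      (hZ.isHermitian.eigenvectorUnitary : Matrix (Fin n) (Fin n) ℂ)) i j)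
  rw [Matrix.mul_sub, Matrix.sub_mul, Matrix.sub_apply]
  refine le_of_eq_of_le ?_ this
  ring

lemma exists_eq_parallelForm (hP : P.PosDef) (hZ : Z.PosDef) (K : Matrix (Fin n) (Fin n) ℂ)
    {τ : ℝ} (hτ : 0 < τ) :
    ∃ X : Matrix (Fin n) (Fin n) ℂ, τ * (trace (Xᴴ * P * X)).re +
      (trace ((K - X)ᴴ * (K - X) * Z)).re = τ * parallelForm hP hZ K τ := by
  let U := (hP.isHermitian.eigenvectorUnitary : Matrix (Fin n) (Fin n) ℂ)
  let V := (hZ.isHermitian.eigenvectorUnitary : Matrix (Fin n) (Fin n) ℂ)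
  let L : Matrix (Fin n) (Fin n) ℂ := Matrix.of fun i j =>
    ((hZ.isHermitian.eigenvalues j /
      (τ * hP.isHermitian.eigenvalues i + hZ.isHermitian.eigenvalues j) : ℝ) : ℂ) *
      (Uᴴ * K * V) i j
  have hU : Uᴴ * U = 1 := Unitary.coe_star_mul_self _
  have hV : Vᴴ * V = 1 := Unitary.coe_star_mul_self _
  have hL : Uᴴ * (U * L * Vᴴ) * V = L := by
    rw [← Matrix.mul_assoc, ← Matrix.mul_assoc, hU, Matrix.one_mul, Matrix.mul_assoc, hV,
      Matrix.mul_one]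
  refine ⟨U * L * Vᴴ, ?_⟩
  rw [re_trace_quadratic_add hP hZ, parallelForm]
  simp only [Finset.mul_sum]
  refine Finset.sum_congr rfl fun i _ => Finset.sum_congr rfl fun j _ => ?_
  rw [Matrix.mul_sub, Matrix.sub_mul, Matrix.sub_apply]
  change _ * Complex.normSq ((Uᴴ * (U * L * Vᴴ) * V) i j) +
    _ * Complex.normSq ((Uᴴ * K * V) i j - (Uᴴ * (U * L * Vᴴ) * V) i j) =
    τ * (_ * Complex.normSq ((Uᴴ * K * V) i j))
  rw [hL]
  refine (weighted_normSq_eq (mul_pos hτ (hP.eigenvalues_pos i)) (hZ.eigenvalues_pos j) _).trans ?_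
  ring

/-- `t • P₁ + (1 - t) • P₂ ≤ P` in the Loewner order, tested on traces. -/
def TraceDominates (t : ℝ) (P₁ P₂ P : Matrix (Fin n) (Fin n) ℂ) : Prop :=
  ∀ X : Matrix (Fin n) (Fin n) ℂ,
    t * (trace (Xᴴ * P₁ * X)).re + (1 - t) * (trace (Xᴴ * P₂ * X)).re ≤ (trace (Xᴴ * P * X)).re

lemma traceDominates_combination (t : ℝ) (P₁ P₂ : Matrix (Fin n) (Fin n) ℂ) :
    TraceDominates t P₁ P₂ (t • P₁ + (1 - t) • P₂) := fun X => by
  simp [Matrix.mul_add, Matrix.add_mul]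

lemma parallelForm_concave {P₁ P₂ Z₁ Z₂ : Matrix (Fin n) (Fin n) ℂ} (hP₁ : P₁.PosDef)
    (hP₂ : P₂.PosDef) (hP : P.PosDef) (hZ₁ : Z₁.PosDef) (hZ₂ : Z₂.PosDef) (hZ : Z.PosDef)
    {t : ℝ} (ht₀ : 0 ≤ t) (ht₁ : t ≤ 1) (hPd : TraceDominates t P₁ P₂ P)
    (hZe : Z = t • Z₁ + (1 - t) • Z₂) (K : Matrix (Fin n) (Fin n) ℂ) {τ : ℝ} (hτ : 0 < τ) :
    t * parallelForm hP₁ hZ₁ K τ + (1 - t) * parallelForm hP₂ hZ₂ K τ ≤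
      parallelForm hP hZ K τ := by
  obtain ⟨X, hX⟩ := exists_eq_parallelForm hP hZ K hτ
  have h1 := mul_le_mul_of_nonneg_left (parallelForm_le hP₁ hZ₁ K X hτ) ht₀
  have h2 := mul_le_mul_of_nonneg_left (parallelForm_le hP₂ hZ₂ K X hτ) (sub_nonneg.2 ht₁)
  have h3 := mul_le_mul_of_nonneg_left (hPd X) hτ.le
  have h4 : (trace ((K - X)ᴴ * (K - X) * Z)).re =
      t * (trace ((K - X)ᴴ * (K - X) * Z₁)).re +
        (1 - t) * (trace ((K - X)ᴴ * (K - X) * Z₂)).re := by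
    rw [hZe]
    simp [Matrix.mul_add]
  refine le_of_mul_le_mul_left ?_ hτ
  linarith

lemma parallelForm_term_eq {u τ a z : ℝ} (hu : u ∈ Set.Ioo 0 1) (hτ : 0 < τ) (ha : 0 < a)
    (hz : 0 < z) :
    τ ^ (u - 1) * (a * z / (τ * a + z)) = a * Real.rpowIntegrand₀₁ u τ (z / a) := by
  rw [Real.rpowIntegrand₀₁_eq_pow_div hu hτ.le (by positivity)]
  field_simp

lemma integrableOn_parallelForm (hP : P.PosDef) (hZ : Z.PosDef) (K : Matrix (Fin n) (Fin n) ℂ)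
    {u : ℝ} (hu : u ∈ Set.Ioo 0 1) :
    IntegrableOn (fun τ => τ ^ (u - 1) * parallelForm hP hZ K τ) (Set.Ioi 0) ∧
    ∫ τ in Set.Ioi 0, τ ^ (u - 1) * parallelForm hP hZ K τ =
      (trace (Kᴴ * mpow P (1 - u) * K * mpow Z u)).re *
        ∫ τ in Set.Ioi 0, Real.rpowIntegrand₀₁ u τ 1 := by
  have hf : Set.EqOn (fun τ => τ ^ (u - 1) * parallelForm hP hZ K τ)
      (fun τ => ∑ i, ∑ j, hP.isHermitian.eigenvalues i *
        Real.rpowIntegrand₀₁ u τ (hZ.isHermitian.eigenvalues j / hP.isHermitian.eigenvalues i) *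
        Complex.normSq (((hP.isHermitian.eigenvectorUnitary : Matrix (Fin n) (Fin n) ℂ)ᴴ * K *
          (hZ.isHermitian.eigenvectorUnitary : Matrix (Fin n) (Fin n) ℂ)) i j)) (Set.Ioi 0) := by
    intro τ hτ
    simp only [parallelForm, Finset.mul_sum]
    refine Finset.sum_congr rfl fun i _ => Finset.sum_congr rfl fun j _ => ?_
    rw [← mul_assoc, parallelForm_term_eq hu hτ (hP.eigenvalues_pos i) (hZ.eigenvalues_pos j)]
  have hint : ∀ i j, IntegrableOn (fun τ => hP.isHermitian.eigenvalues i *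
        Real.rpowIntegrand₀₁ u τ (hZ.isHermitian.eigenvalues j / hP.isHermitian.eigenvalues i) *
        Complex.normSq (((hP.isHermitian.eigenvectorUnitary : Matrix (Fin n) (Fin n) ℂ)ᴴ * K *
          (hZ.isHermitian.eigenvectorUnitary : Matrix (Fin n) (Fin n) ℂ)) i j)) (Set.Ioi 0) :=
    fun i j => ((Real.integrableOn_rpowIntegrand₀₁_Ioi hu
      (div_pos (hZ.eigenvalues_pos j) (hP.eigenvalues_pos i)).le).const_mul _).mul_const _
  constructor
  · rw [integrableOn_congr_fun hf measurableSet_Ioi]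
    exact integrable_finsetSum _ fun i _ => integrable_finsetSum _ fun j _ => hint i j
  · rw [setIntegral_congr_fun measurableSet_Ioi hf, integral_finsetSum _
      fun i _ => integrable_finsetSum _ fun j _ => hint i j, re_trace_mpow_mul_mpow hP hZ,
      Finset.sum_mul]
    refine Finset.sum_congr rfl fun i _ => ?_
    rw [integral_finsetSum _ fun j _ => hint i j, Finset.sum_mul]
    refine Finset.sum_congr rfl fun j _ => ?_
    have ha := hP.eigenvalues_pos i
    have hz := hZ.eigenvalues_pos j
    rw [integral_mul_const, integral_const_mul,
      Real.integral_rpowIntegrand₀₁_eq_rpow_mul_const hu (by positivity),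
      Real.div_rpow hz.le ha.le, Real.rpow_sub ha, Real.rpow_one]
    ring

/-- Lieb's concavity theorem for exponents with sum one. -/
lemma lieb_concavity {P₁ P₂ Z₁ Z₂ : Matrix (Fin n) (Fin n) ℂ} (hP₁ : P₁.PosDef)
    (hP₂ : P₂.PosDef) (hP : P.PosDef) (hZ₁ : Z₁.PosDef) (hZ₂ : Z₂.PosDef) (hZ : Z.PosDef)
    {t : ℝ} (ht₀ : 0 ≤ t) (ht₁ : t ≤ 1) (hPd : TraceDominates t P₁ P₂ P)
    (hZe : Z = t • Z₁ + (1 - t) • Z₂) (K : Matrix (Fin n) (Fin n) ℂ) {u : ℝ}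
    (hu : u ∈ Set.Ioo 0 1) :
    t * (trace (Kᴴ * mpow P₁ (1 - u) * K * mpow Z₁ u)).re +
      (1 - t) * (trace (Kᴴ * mpow P₂ (1 - u) * K * mpow Z₂ u)).re ≤
      (trace (Kᴴ * mpow P (1 - u) * K * mpow Z u)).re := by
  obtain ⟨i1, e1⟩ := integrableOn_parallelForm hP₁ hZ₁ K hu
  obtain ⟨i2, e2⟩ := integrableOn_parallelForm hP₂ hZ₂ K hu
  obtain ⟨i0, e0⟩ := integrableOn_parallelForm hP hZ K hu
  have hc : 0 < ∫ τ in Set.Ioi 0, Real.rpowIntegrand₀₁ u τ 1 := by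
    refine lt_of_lt_of_le ?_ (Real.le_integral_rpowIntegrand₀₁_one hu)
    exact div_pos_of_neg_of_neg (by norm_num) (by linarith [hu.2])
  have hmono := setIntegral_mono_on ((i1.const_mul t).add (i2.const_mul (1 - t))) i0
    measurableSet_Ioi fun τ (hτ : 0 < τ) => by
      have := mul_le_mul_of_nonneg_left
        (parallelForm_concave hP₁ hP₂ hP hZ₁ hZ₂ hZ ht₀ ht₁ hPd hZe K hτ)
        (Real.rpow_nonneg hτ.le (u - 1))
      simp only [Pi.add_apply]
      linarith
  simp only [Pi.add_apply] at hmono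
  rw [integral_add (i1.const_mul t) (i2.const_mul (1 - t)), integral_const_mul,
    integral_const_mul, e1, e2, e0] at hmono
  refine le_of_mul_le_mul_right ?_ hc
  linarith

lemma posDef_combination (hA : A.PosDef) (hB : B.PosDef) {t : ℝ} (ht₀ : 0 ≤ t) (ht₁ : t ≤ 1) :
    (t • A + (1 - t) • B).PosDef := by
  rcases ht₀.eq_or_lt with rfl | ht
  · simpa using hB
  · exact (hA.smul ht).add_posSemidef (hB.posSemidef.smul (sub_nonneg.2 ht₁))

/-- Operator concavity of `x ↦ x ^ ρ` for `0 ≤ ρ ≤ 1`. -/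
lemma traceDominates_mpow {E₁ E₂ : Matrix (Fin n) (Fin n) ℂ} (hE₁ : E₁.PosDef)
    (hE₂ : E₂.PosDef) {t : ℝ} (ht₀ : 0 ≤ t) (ht₁ : t ≤ 1) {ρ : ℝ} (hρ₀ : 0 ≤ ρ) (hρ₁ : ρ ≤ 1) :
    TraceDominates t (mpow E₁ ρ) (mpow E₂ ρ) (mpow (t • E₁ + (1 - t) • E₂) ρ) := by
  have hE := posDef_combination hE₁ hE₂ ht₀ ht₁
  rcases hρ₀.eq_or_lt with rfl | hρ₀
  · rw [mpow_zero hE₁, mpow_zero hE₂, mpow_zero hE]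
    intro X
    linarith
  rcases hρ₁.eq_or_lt with rfl | hρ₁
  · rw [mpow_one hE₁, mpow_one hE₂, mpow_one hE]
    exact traceDominates_combination t E₁ E₂
  intro K
  have h1 : (1 : Matrix (Fin n) (Fin n) ℂ) = t • 1 + (1 - t) • 1 := by
    rw [← add_smul, add_sub_cancel, one_smul]
  have := lieb_concavity hE₁ hE₂ hE PosDef.one PosDef.one PosDef.one ht₀ ht₁
    (traceDominates_combination t E₁ E₂) h1 K (u := 1 - ρ) ⟨by linarith, by linarith⟩
  simpa only [sub_sub_cancel, mpow_one_matrix, Matrix.mul_one] using this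

lemma trace_mul_mpow (hA : A.PosDef) (s : ℝ) :
    trace (A * mpow A (s - 1)) = trace (mpow A s) := by
  conv_lhs => rw [← mpow_one hA, mpow_mpow hA, mpow_mul_mpow hA]
  congr 2
  ring

/-- Epstein's concavity theorem for exponents `θ > 1`. -/
lemma epstein_concavity {E₁ E₂ R : Matrix (Fin n) (Fin n) ℂ} (hE₁ : E₁.PosDef)
    (hE₂ : E₂.PosDef) (hR : R.PosDef) {t : ℝ} (ht₀ : 0 ≤ t) (ht₁ : t ≤ 1) {d θ : ℝ}
    (hθ : 1 < θ) (hd₀ : 0 ≤ d) (hd₁ : d * θ ≤ 1) :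
    t * (trace (mpow (R * mpow E₁ d * R) θ)).re +
      (1 - t) * (trace (mpow (R * mpow E₂ d * R) θ)).re ≤
      (trace (mpow (R * mpow (t • E₁ + (1 - t) • E₂) d * R) θ)).re := by
  have hE := posDef_combination hE₁ hE₂ ht₀ ht₁
  have hθ0 : θ ≠ 0 := by linarith
  have hθ1 : θ - 1 ≠ 0 := by linarith
  have hM {F : Matrix (Fin n) (Fin n) ℂ} (hF : F.PosDef) : (R * mpow F d * R).PosDef :=
    posDef_conj (posDef_mpow hF d) hR
  set Z₁ := mpow (R * mpow E₁ d * R) θ with hZ₁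
  set Z₂ := mpow (R * mpow E₂ d * R) θ with hZ₂
  have pZ₁ : Z₁.PosDef := posDef_mpow (hM hE₁) θ
  have pZ₂ : Z₂.PosDef := posDef_mpow (hM hE₂) θ
  set E := t • E₁ + (1 - t) • E₂
  set Z := t • Z₁ + (1 - t) • Z₂ with hZ
  have pZ : Z.PosDef := posDef_combination pZ₁ pZ₂ ht₀ ht₁
  set u := 1 - 1 / θ with hu
  have hu1 : 1 - u = 1 / θ := by rw [hu]; ring
  have hu' : u ∈ Set.Ioo 0 1 := by
    have h1 : 1 / θ < 1 := by rw [div_lt_one (by linarith)]; exact hθ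
    have h2 : 0 < 1 / θ := by positivity
    exact ⟨by linarith, by linarith⟩
  have hlieb := lieb_concavity (posDef_mpow hE₁ (d * θ)) (posDef_mpow hE₂ (d * θ))
    (posDef_mpow hE (d * θ)) pZ₁ pZ₂ pZ ht₀ ht₁
    (traceDominates_mpow hE₁ hE₂ ht₀ ht₁ (mul_nonneg hd₀ (by linarith)) hd₁) hZ R hu'
  have hdθ : d * θ * (1 / θ) = d := by field_simp
  have hend {F : Matrix (Fin n) (Fin n) ℂ} (hF : F.PosDef) :
      (trace (R * mpow F d * R * mpow (mpow (R * mpow F d * R) θ) u)).re =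
        (trace (mpow (R * mpow F d * R) θ)).re := by
    rw [mpow_mpow (hM hF), show θ * u = θ - 1 by rw [hu]; field_simp, trace_mul_mpow (hM hF)]
  rw [hu1, mpow_mpow hE₁, mpow_mpow hE₂, mpow_mpow hE, hdθ, hR.isHermitian.eq, hZ₁, hZ₂,
    hend hE₁, hend hE₂, ← hZ₁, ← hZ₂] at hlieb
  have hyoung := young_trace (hM hE) (posDef_mpow pZ u) hθ
  rw [mpow_mpow pZ, show u * (θ / (θ - 1)) = 1 by rw [hu]; field_simp, mpow_one pZ] at hyoung
  have hZt : (trace Z).re = t * (trace Z₁).re + (1 - t) * (trace Z₂).re := by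
    rw [hZ]
    simp
  rw [hZt] at hyoung
  have := mul_le_mul_of_nonneg_left hlieb (by linarith : 0 ≤ θ)
  linarith

lemma two_mul_re_trace_sub_le {C R : Matrix (Fin n) (Fin n) ℂ} (hB : B.IsHermitian)
    (hC : C.PosDef) (hR : R.IsHermitian) (X : Matrix (Fin n) (Fin n) ℂ) :
    2 * (trace (Xᴴ * B * R)).re - (trace (Xᴴ * C * X)).re ≤
      (trace (R * (B * mpow C (-1) * B) * R)).re := by
  have hCp := (posDef_mpow hC (1 / 2)).isHermitian.eq
  have hCm := (posDef_mpow hC (-(1 / 2))).isHermitian.eq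
  set D := mpow C (1 / 2) * X - mpow C (-(1 / 2)) * B * R with hD
  have h0 : 0 ≤ (trace (Dᴴ * D)).re :=
    (Complex.le_def.1 (posSemidef_conjTranspose_mul_self D).trace_nonneg).1
  have e1 : Dᴴ * D = Xᴴ * (mpow C (1 / 2) * mpow C (1 / 2)) * X
      - Xᴴ * (mpow C (1 / 2) * mpow C (-(1 / 2))) * B * R
      - R * B * (mpow C (-(1 / 2)) * mpow C (1 / 2)) * X
      + R * B * (mpow C (-(1 / 2)) * mpow C (-(1 / 2))) * B * R := by
    rw [hD]
    simp only [conjTranspose_sub, conjTranspose_mul, hCp, hCm, hB.eq, hR.eq, Matrix.sub_mul,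
      Matrix.mul_sub, Matrix.mul_assoc]
    abel
  rw [mpow_half_mul_self hC, mpow_mul_mpow_neg hC, mpow_neg_mul_mpow hC, mpow_mul_mpow hC,
    show -(1 / 2 : ℝ) + -(1 / 2) = -1 by norm_num, Matrix.mul_one, Matrix.mul_one] at e1
  have e2 : (trace (R * B * X)).re = (trace (Xᴴ * B * R)).re := by
    have : (Xᴴ * B * R)ᴴ = R * B * X := by
      simp only [conjTranspose_mul, conjTranspose_conjTranspose, hB.eq, hR.eq, Matrix.mul_assoc]
    rw [← this, trace_conjTranspose, Complex.star_def, Complex.conj_re]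
  rw [e1] at h0
  simp only [trace_add, trace_sub, Complex.add_re, Complex.sub_re, e2] at h0
  simp only [Matrix.mul_assoc] at h0 ⊢
  linarith

lemma quadratic_inverse_convex {B₁ B₂ C₁ C₂ C R : Matrix (Fin n) (Fin n) ℂ}
    (hB₁ : B₁.IsHermitian) (hB₂ : B₂.IsHermitian) (hB : B.IsHermitian)
    (hC₁ : C₁.PosDef) (hC₂ : C₂.PosDef) (hC : C.PosDef)
    (hR : R.IsHermitian) {t : ℝ} (ht₀ : 0 ≤ t) (ht₁ : t ≤ 1) (hBe : B = t • B₁ + (1 - t) • B₂)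
    (hCd : TraceDominates t C₁ C₂ C) :
    (trace (R * (B * mpow C (-1) * B) * R)).re ≤
      t * (trace (R * (B₁ * mpow C₁ (-1) * B₁) * R)).re +
      (1 - t) * (trace (R * (B₂ * mpow C₂ (-1) * B₂) * R)).re := by
  set X := mpow C (-1) * B * R with hX
  have hXh : Xᴴ = R * B * mpow C (-1) := by
    simp only [hX, conjTranspose_mul, hB.eq, hR.eq, (posDef_mpow hC (-1)).isHermitian.eq,
      Matrix.mul_assoc]
  have e1 : Xᴴ * B * R = R * (B * mpow C (-1) * B) * R := by
    simp only [hXh, Matrix.mul_assoc]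
  have e2 : Xᴴ * C * X = R * (B * mpow C (-1) * B) * R := by
    have : mpow C (-1) * C = 1 := by
      simpa only [mpow_one hC] using mpow_neg_mul_mpow hC 1
    rw [hXh, Matrix.mul_assoc _ (mpow C (-1)) C, this, Matrix.mul_one, hX]
    simp only [Matrix.mul_assoc]
  have e3 : (trace (Xᴴ * B * R)).re =
      t * (trace (Xᴴ * B₁ * R)).re + (1 - t) * (trace (Xᴴ * B₂ * R)).re := by
    rw [hBe]
    simp [Matrix.mul_add, Matrix.add_mul]
  have h1 := mul_le_mul_of_nonneg_left (two_mul_re_trace_sub_le hB₁ hC₁ hR X) ht₀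
  have h2 := mul_le_mul_of_nonneg_left (two_mul_re_trace_sub_le hB₂ hC₂ hR X) (sub_nonneg.2 ht₁)
  have h3 := hCd X
  rw [e2] at h3
  rw [e1] at e3
  linarith

/-- The matrix `E ^ (-d/2) * B * C⁻¹ * B * E ^ (-d/2)`. -/
noncomputable def sandwich (d : ℝ) (B C E : Matrix (Fin n) (Fin n) ℂ) :
    Matrix (Fin n) (Fin n) ℂ :=
  mpow E (-(d / 2)) * (B * mpow C (-1) * B) * mpow E (-(d / 2))

lemma posDef_sandwich {C E : Matrix (Fin n) (Fin n) ℂ} (hB : B.PosDef) (hC : C.PosDef)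
    (hE : E.PosDef) (d : ℝ) : (sandwich d B C E).PosDef :=
  posDef_conj (posDef_conj (posDef_mpow hC _) hB) (posDef_mpow hE _)

lemma trace_sandwich_mul {C E R : Matrix (Fin n) (Fin n) ℂ} (hE : E.PosDef) (d : ℝ) :
    trace (sandwich d B C E * (mpow E (d / 2) * (R * R) * mpow E (d / 2))) =
      trace (R * (B * mpow C (-1) * B) * R) := by
  have e : sandwich d B C E * (mpow E (d / 2) * (R * R) * mpow E (d / 2)) =
      mpow E (-(d / 2)) * (B * mpow C (-1) * B) * (mpow E (-(d / 2)) * mpow E (d / 2)) *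
        (R * R) * mpow E (d / 2) := by
    simp only [sandwich, Matrix.mul_assoc]
  have e' : mpow E (d / 2) * (mpow E (-(d / 2)) * (B * mpow C (-1) * B) * (R * R)) =
      mpow E (d / 2) * mpow E (-(d / 2)) * (B * mpow C (-1) * B * R) * R := by
    simp only [Matrix.mul_assoc]
  rw [e, mpow_neg_mul_mpow hE, Matrix.mul_one, Matrix.trace_mul_comm, e', mpow_mul_mpow_neg hE,
    Matrix.one_mul, Matrix.trace_mul_comm, ← Matrix.mul_assoc]

lemma trace_mpow_conj_sq {E R : Matrix (Fin n) (Fin n) ℂ} (hE : E.PosDef) (hR : R.IsHermitian)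
    (d θ : ℝ) :
    trace (mpow (mpow E (d / 2) * (R * R) * mpow E (d / 2)) θ) =
      trace (mpow (R * mpow E d * R) θ) := by
  have h := trace_mpow_mul_conjTranspose_comm (mpow E (d / 2) * R) θ
  rw [conjTranspose_mul, hR.eq, (posDef_mpow hE _).isHermitian.eq] at h
  have e1 : mpow E (d / 2) * R * (R * mpow E (d / 2)) =
      mpow E (d / 2) * (R * R) * mpow E (d / 2) := by simp only [Matrix.mul_assoc]
  have e2 : R * mpow E (d / 2) * (mpow E (d / 2) * R) = R * mpow E d * R := by
    rw [← Matrix.mul_assoc, Matrix.mul_assoc R, mpow_mul_mpow hE, add_halves]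
  rwa [e1, e2] at h

lemma young_sandwich {C E R : Matrix (Fin n) (Fin n) ℂ} (hB : B.PosDef) (hC : C.PosDef)
    (hE : E.PosDef) (hR : R.PosDef) (d : ℝ) {s : ℝ} (hs : 1 < s) :
    s * (trace (R * (B * mpow C (-1) * B) * R)).re ≤ (trace (mpow (sandwich d B C E) s)).re +
      (s - 1) * (trace (mpow (R * mpow E d * R) (s / (s - 1)))).re := by
  have hRR : (R * R).PosDef := by simpa using posDef_conj PosDef.one hR
  have h := young_trace (posDef_sandwich hB hC hE d)
    (posDef_conj hRR (posDef_mpow hE (d / 2))) hs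
  rwa [trace_sandwich_mul hE, trace_mpow_conj_sq hE hR.isHermitian] at h

lemma exists_eq_young_sandwich {C E : Matrix (Fin n) (Fin n) ℂ} (hB : B.PosDef) (hC : C.PosDef)
    (hE : E.PosDef) (d : ℝ) {s : ℝ} (hs : 1 < s) :
    ∃ R : Matrix (Fin n) (Fin n) ℂ, R.PosDef ∧
      s * (trace (R * (B * mpow C (-1) * B) * R)).re = (trace (mpow (sandwich d B C E) s)).re +
      (s - 1) * (trace (mpow (R * mpow E d * R) (s / (s - 1)))).re := by
  have hM := posDef_sandwich hB hC hE d
  set Y := mpow E (-(d / 2)) * mpow (sandwich d B C E) (s - 1) * mpow E (-(d / 2)) with hYd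
  have hY : Y.PosDef := posDef_conj (posDef_mpow hM _) (posDef_mpow hE _)
  have hR := posDef_mpow hY (1 / 2)
  refine ⟨mpow Y (1 / 2), hR, ?_⟩
  have hZ : mpow E (d / 2) * (mpow Y (1 / 2) * mpow Y (1 / 2)) * mpow E (d / 2) =
      mpow (sandwich d B C E) (s - 1) := by
    have e : mpow E (d / 2) * Y * mpow E (d / 2) =
        (mpow E (d / 2) * mpow E (-(d / 2))) * mpow (sandwich d B C E) (s - 1) *
          (mpow E (-(d / 2)) * mpow E (d / 2)) := by simp only [hYd, Matrix.mul_assoc]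
    rw [mpow_half_mul_self hY, e, mpow_mul_mpow_neg hE, mpow_neg_mul_mpow hE, Matrix.one_mul,
      Matrix.mul_one]
  have hs1 : s - 1 ≠ 0 := by linarith
  rw [← trace_sandwich_mul hE d, ← trace_mpow_conj_sq hE hR.isHermitian, hZ,
    trace_mul_mpow hM, mpow_mpow hM, mul_div_cancel₀ _ hs1]
  ring

lemma sandwich_trace_convex {B₁ B₂ C₁ C₂ C E₁ E₂ : Matrix (Fin n) (Fin n) ℂ}
    (hB₁ : B₁.PosDef) (hB₂ : B₂.PosDef) (hC₁ : C₁.PosDef) (hC₂ : C₂.PosDef) (hC : C.PosDef)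
    (hE₁ : E₁.PosDef) (hE₂ : E₂.PosDef) {t : ℝ} (ht₀ : 0 ≤ t) (ht₁ : t ≤ 1)
    (hCd : TraceDominates t C₁ C₂ C) {d s : ℝ} (hd : 0 ≤ d) (hs : 1 ≤ s) (hds : d * s ≤ s - 1) :
    (trace (mpow (sandwich d (t • B₁ + (1 - t) • B₂) C (t • E₁ + (1 - t) • E₂)) s)).re ≤
      t * (trace (mpow (sandwich d B₁ C₁ E₁) s)).re +
      (1 - t) * (trace (mpow (sandwich d B₂ C₂ E₂) s)).re := by
  have hB := posDef_combination hB₁ hB₂ ht₀ ht₁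
  have hE := posDef_combination hE₁ hE₂ ht₀ ht₁
  rcases hs.eq_or_lt with rfl | hs
  · obtain rfl : d = 0 := by linarith
    have h := quadratic_inverse_convex hB₁.isHermitian hB₂.isHermitian hB.isHermitian hC₁ hC₂ hC
      isHermitian_one ht₀ ht₁ rfl hCd
    rw [mpow_one (posDef_sandwich hB hC hE 0), mpow_one (posDef_sandwich hB₁ hC₁ hE₁ 0),
      mpow_one (posDef_sandwich hB₂ hC₂ hE₂ 0)]
    simpa only [sandwich, zero_div, neg_zero, mpow_zero hE, mpow_zero hE₁, mpow_zero hE₂] using h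
  · obtain ⟨R, hR, h0⟩ := exists_eq_young_sandwich hB hC hE d hs
    have h1 := mul_le_mul_of_nonneg_left (young_sandwich hB₁ hC₁ hE₁ hR d hs) ht₀
    have h2 := mul_le_mul_of_nonneg_left (young_sandwich hB₂ hC₂ hE₂ hR d hs) (sub_nonneg.2 ht₁)
    have hs1 : 0 < s - 1 := by linarith
    have h3 := mul_le_mul_of_nonneg_left (quadratic_inverse_convex hB₁.isHermitian
      hB₂.isHermitian hB.isHermitian hC₁ hC₂ hC hR.isHermitian ht₀ ht₁ rfl hCd)
      (by linarith : 0 ≤ s)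
    have h4 := mul_le_mul_of_nonneg_left (epstein_concavity hE₁ hE₂ hR ht₀ ht₁
      (θ := s / (s - 1)) ((one_lt_div hs1).2 (by linarith)) hd
      (by rw [← mul_div_assoc, div_le_one hs1]; exact hds)) hs1.le
    linarith

lemma mul_mpow_mul_self (hB : B.PosDef) (r : ℝ) : B * mpow B r * B = mpow B (r + 2) := by
  conv_lhs => enter [1, 1]; rw [← mpow_one hB]
  conv_lhs => enter [2]; rw [← mpow_one hB]
  rw [mpow_mul_mpow hB, mpow_mul_mpow hB]
  congr 1
  ring

lemma phi_eq_sandwich_left (A : Matrix (Fin n) (Fin n) ℂ) (hB : B.PosDef)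
    (p q s : ℝ) :
    Phi p q s A B = (trace (mpow (sandwich (-q) B (mpow B (2 - p)) A) s)).re := by
  rw [Phi, sandwich, mpow_mpow hB, mul_mpow_mul_self hB]
  ring_nf

lemma phi_eq_sandwich_right (hA : A.PosDef) (hB : B.PosDef) (p q s : ℝ) :
    Phi p q s A B = (trace (mpow (sandwich (2 - p) B (mpow A (-q)) B) s)).re := by
  have h := trace_mpow_mul_conjTranspose_comm (mpow A (q / 2) * mpow B (p / 2)) s
  rw [conjTranspose_mul, (posDef_mpow hA _).isHermitian.eq, (posDef_mpow hB _).isHermitian.eq] at h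
  have e1 : mpow A (q / 2) * mpow B (p / 2) * (mpow B (p / 2) * mpow A (q / 2)) =
      mpow A (q / 2) * mpow B p * mpow A (q / 2) := by
    rw [← Matrix.mul_assoc, Matrix.mul_assoc (mpow A _), mpow_mul_mpow hB, add_halves]
  have e2 : mpow B (p / 2) * mpow A (q / 2) * (mpow A (q / 2) * mpow B (p / 2)) =
      mpow B (p / 2) * mpow A q * mpow B (p / 2) := by
    rw [← Matrix.mul_assoc, Matrix.mul_assoc (mpow B _), mpow_mul_mpow hA, add_halves]
  have e3 : sandwich (2 - p) B (mpow A (-q)) B = mpow B (p / 2) * mpow A q * mpow B (p / 2) := by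
    have l : mpow B (-((2 - p) / 2)) * B = mpow B (p / 2) := by
      conv_lhs => enter [2]; rw [← mpow_one hB]
      rw [mpow_mul_mpow hB]
      congr 1
      ring
    have r : B * mpow B (-((2 - p) / 2)) = mpow B (p / 2) := by
      conv_lhs => enter [1]; rw [← mpow_one hB]
      rw [mpow_mul_mpow hB]
      congr 1
      ring
    rw [sandwich, mpow_mpow hA, neg_mul_neg, mul_one]
    nth_rw 1 [← l]
    rw [← r]
    simp only [Matrix.mul_assoc]
  rw [Phi, e3, ← e1, h, e2]

end TraceConvexity

open TraceConvexity in
/-- Theorem 4.1: for `p ∈ [1,2]`, `q ∈ [−1,0)` and `s ≥ min{1/(p−1), 1/(1+q)}`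
(with `1/(p−1) = +∞` for `p = 1` and `1/(1+q) = +∞` for `q = −1`, so that the
condition reads `s ≥ 1/(p−1)` with `p > 1`, or `s ≥ 1/(1+q)` with `q > −1`),
`Φ_{p,q,s}` is jointly convex. -/
theorem phi_jointly_convex_larges (p q s : ℝ) (hp₁ : 1 ≤ p) (hp₂ : p ≤ 2)
    (hq₁ : -1 ≤ q) (hq₂ : q < 0)
    (hs : (1 < p ∧ 1 / (p - 1) ≤ s) ∨ (-1 < q ∧ 1 / (1 + q) ≤ s)) (n : ℕ) :
    JointlyConvex (Phi (n := n) p q s) := by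
  intro A₁ A₂ B₁ B₂ hA₁ hA₂ hB₁ hB₂ t ht₀ ht₁
  have hA := posDef_combination hA₁ hA₂ ht₀ ht₁
  have hB := posDef_combination hB₁ hB₂ ht₀ ht₁
  rcases hs with ⟨hp, hs⟩ | ⟨hq, hs⟩
  · rw [div_le_iff₀ (by linarith)] at hs
    rw [phi_eq_sandwich_right hA hB, phi_eq_sandwich_right hA₁ hB₁, phi_eq_sandwich_right hA₂ hB₂]
    exact sandwich_trace_convex hB₁ hB₂ (posDef_mpow hA₁ _) (posDef_mpow hA₂ _)
      (posDef_mpow hA _) hB₁ hB₂ ht₀ ht₁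
      (traceDominates_mpow hA₁ hA₂ ht₀ ht₁ (by linarith) (by linarith)) (by linarith)
      (by nlinarith) (by linarith)
  · rw [div_le_iff₀ (by linarith)] at hs
    rw [phi_eq_sandwich_left _ hB, phi_eq_sandwich_left _ hB₁, phi_eq_sandwich_left _ hB₂]
    exact sandwich_trace_convex hB₁ hB₂ (posDef_mpow hB₁ _) (posDef_mpow hB₂ _)
      (posDef_mpow hB _) hA₁ hA₂ ht₀ ht₁
      (traceDominates_mpow hB₁ hB₂ ht₀ ht₁ (by linarith) (by linarith)) (by linarith)
      (by nlinarith) (by linarith)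
end

section
/- Let q ∈ [−1,0) and let s be a real number with s ≥ 1/(2+q). Then for every n, the trace function Φ_{2,q,s}(A,B) = Tr[(A^{q/2} B^2 A^{q/2})^s] is jointly convex on pairs of n×n positive definite complex matrices. -/
open Matrix
open scoped ComplexOrder

section MatrixPower

variable {n : ℕ} {A X : Matrix (Fin n) (Fin n) ℂ}

lemma mpow_eq_cfc (hA : A.IsHermitian) (r : ℝ) : mpow A r = cfc (fun x : ℝ => x ^ r) A := by
  rw [hA.cfc_eq, mpow, dif_pos hA, IsHermitian.cfc, Unitary.conjStarAlgAut_apply]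
  rfl

lemma Matrix.PosDef.spectrum_pos (hA : A.PosDef) {x : ℝ} (hx : x ∈ spectrum ℝ A) : 0 < x := by
  rw [hA.isHermitian.spectrum_real_eq_range_eigenvalues] at hx
  obtain ⟨i, rfl⟩ := hx
  exact hA.eigenvalues_pos i

lemma continuousOn_spectrum (A : Matrix (Fin n) (Fin n) ℂ) (f : ℝ → ℝ) :
    ContinuousOn f (spectrum ℝ A) :=
  (Matrix.finite_real_spectrum (A := A)).continuousOn f

lemma mpow_isHermitian_s11 (hA : A.IsHermitian) (r : ℝ) : (mpow A r).IsHermitian := by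
  rw [mpow_eq_cfc hA]
  exact cfc_predicate _ A

lemma mpow_posDef (hA : A.PosDef) (r : ℝ) : (mpow A r).PosDef := by
  rw [mpow, dif_pos hA.isHermitian]
  have hD : (Matrix.diagonal
      (fun i => ((hA.isHermitian.eigenvalues i ^ r : ℝ) : ℂ))).PosDef := by
    rw [Matrix.posDef_diagonal_iff]
    intro i
    exact_mod_cast Real.rpow_pos_of_pos (hA.eigenvalues_pos i) r
  have := hD.mul_mul_conjTranspose_same (B := (hA.isHermitian.eigenvectorUnitary :
    Matrix (Fin n) (Fin n) ℂ)) ?_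
  · exact this
  · exact Matrix.vecMul_injective_of_isUnit (Unitary.toUnits hA.isHermitian.eigenvectorUnitary).isUnit

lemma mpow_mul_mpow (hA : A.PosDef) (r s : ℝ) : mpow A r * mpow A s = mpow A (r + s) := by
  have hH := hA.isHermitian
  rw [mpow_eq_cfc hH, mpow_eq_cfc hH, mpow_eq_cfc hH,
    ← cfc_mul _ _ A (continuousOn_spectrum A _) (continuousOn_spectrum A _)]
  refine cfc_congr fun x hx => ?_
  exact (Real.rpow_add (hA.spectrum_pos hx) r s).symm

lemma mpow_mpow (hA : A.PosDef) (r s : ℝ) : mpow (mpow A r) s = mpow A (r * s) := by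
  have hH := hA.isHermitian
  have hcomp := cfc_comp' (fun x : ℝ => x ^ s) (fun x : ℝ => x ^ r) A
    ((Set.Finite.image _ Matrix.finite_real_spectrum).continuousOn _)
    (continuousOn_spectrum A _) hH
  rw [mpow_eq_cfc (mpow_isHermitian_s11 hH r), mpow_eq_cfc hH, mpow_eq_cfc hH]
  refine hcomp.symm.trans (cfc_congr fun x hx => ?_)
  exact (Real.rpow_mul (hA.spectrum_pos hx).le r s).symm

lemma mpow_zero (hA : A.IsHermitian) : mpow A 0 = 1 := by
  rw [mpow_eq_cfc hA]
  simp only [Real.rpow_zero]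
  exact cfc_const_one ℝ A hA

lemma mpow_one (hA : A.IsHermitian) : mpow A 1 = A := by
  rw [mpow_eq_cfc hA]
  simp only [Real.rpow_one]
  exact cfc_id' ℝ A hA

lemma one_mpow (r : ℝ) : mpow (1 : Matrix (Fin n) (Fin n) ℂ) r = 1 := by
  rw [mpow_eq_cfc Matrix.isHermitian_one, cfc_apply_one]
  simp

lemma mpow_two (hA : A.PosDef) : mpow A 2 = A * A := by
  nth_rw 2 3 [← mpow_one hA.isHermitian]
  rw [mpow_mul_mpow hA]
  norm_num

lemma trace_mpow (hA : A.IsHermitian) (r : ℝ) :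
    (mpow A r).trace = ((A.charpoly.roots.map fun z => ((z.re ^ r : ℝ) : ℂ)).sum) := by
  rw [hA.roots_charpoly_eq_eigenvalues, mpow, dif_pos hA, Matrix.trace_mul_cycle]
  simp [Matrix.trace_diagonal, List.sum_ofFn]

lemma trace_mpow_mul_comm {M N : Matrix (Fin n) (Fin n) ℂ} (h : (M * N).IsHermitian)
    (h' : (N * M).IsHermitian) (r : ℝ) : (mpow (M * N) r).trace = (mpow (N * M) r).trace := by
  rw [trace_mpow h, trace_mpow h', Matrix.charpoly_mul_comm]

end MatrixPower

section SpectralForm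

variable {n : ℕ} {A X : Matrix (Fin n) (Fin n) ℂ}

/-- The matrix `W` expressed in eigenbases of `A` and `X`. -/
noncomputable def eigenCoord (hA : A.IsHermitian) (hX : X.IsHermitian)
    (W : Matrix (Fin n) (Fin n) ℂ) : Matrix (Fin n) (Fin n) ℂ :=
  (hA.eigenvectorUnitary : Matrix (Fin n) (Fin n) ℂ)ᴴ * W * hX.eigenvectorUnitary

/-- The quadratic form of the double operator `τ(L_A, R_X)`, where `L_A` is left multiplication
by `A` and `R_X` is right multiplication by `X`. -/
noncomputable def spectralForm (hA : A.IsHermitian) (hX : X.IsHermitian) (τ : ℝ → ℝ → ℝ)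
    (W : Matrix (Fin n) (Fin n) ℂ) : ℝ :=
  ∑ i, ∑ j, Complex.normSq (eigenCoord hA hX W i j) * τ (hA.eigenvalues i) (hX.eigenvalues j)

lemma eigenCoord_surjective (hA : A.IsHermitian) (hX : X.IsHermitian) :
    Function.Surjective (eigenCoord hA hX) := by
  intro Z
  refine ⟨hA.eigenvectorUnitary * Z * (hX.eigenvectorUnitary : Matrix (Fin n) (Fin n) ℂ)ᴴ, ?_⟩
  have h1 : (hA.eigenvectorUnitary : Matrix (Fin n) (Fin n) ℂ)ᴴ * hA.eigenvectorUnitary = 1 :=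
    Unitary.coe_star_mul_self _
  have h2 : (hX.eigenvectorUnitary : Matrix (Fin n) (Fin n) ℂ)ᴴ * hX.eigenvectorUnitary = 1 :=
    Unitary.coe_star_mul_self _
  simp only [eigenCoord, Matrix.mul_assoc, h2, Matrix.mul_one]
  rw [← Matrix.mul_assoc, h1, Matrix.one_mul]

lemma eigenCoord_sub (hA : A.IsHermitian) (hX : X.IsHermitian)
    (V W : Matrix (Fin n) (Fin n) ℂ) :
    eigenCoord hA hX (V - W) = eigenCoord hA hX V - eigenCoord hA hX W := by
  simp [eigenCoord, Matrix.mul_sub, Matrix.sub_mul]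

lemma re_trace_conjTranspose_mul_diagonal (Z : Matrix (Fin n) (Fin n) ℂ) (d e : Fin n → ℝ) :
    (Zᴴ * Matrix.diagonal (fun i => (d i : ℂ)) * Z * Matrix.diagonal (fun i => (e i : ℂ))).trace.re
      = ∑ i, ∑ j, Complex.normSq (Z i j) * (d i * e j) := by
  rw [Finset.sum_comm]
  simp only [Matrix.trace, Matrix.diag_apply, Matrix.mul_diagonal]
  simp only [Matrix.mul_apply (M := _ * _), Matrix.mul_diagonal,
    Matrix.conjTranspose_apply, Complex.re_sum, Finset.sum_mul]
  refine Finset.sum_congr rfl fun j _ => Finset.sum_congr rfl fun i _ => ?_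
  simp [Complex.normSq_apply]
  ring

lemma re_trace_mpow_mul_mpow (hA : A.IsHermitian) (hX : X.IsHermitian) (a b : ℝ)
    (W : Matrix (Fin n) (Fin n) ℂ) :
    (Wᴴ * mpow A a * W * mpow X b).trace.re = spectralForm hA hX (fun x y => x ^ a * y ^ b) W := by
  rw [spectralForm, ← re_trace_conjTranspose_mul_diagonal _ (fun i => hA.eigenvalues i ^ a)
    (fun j => hX.eigenvalues j ^ b), mpow, mpow, dif_pos hA, dif_pos hX]
  simp only [eigenCoord, Matrix.conjTranspose_mul, Matrix.conjTranspose_conjTranspose,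
    ← Matrix.mul_assoc]
  rw [Matrix.trace_mul_comm]
  simp only [Matrix.mul_assoc]
  rfl

lemma re_trace_mul_mul_self (hA : A.IsHermitian) (hX : X.IsHermitian)
    (W : Matrix (Fin n) (Fin n) ℂ) :
    (Wᴴ * A * W).trace.re = spectralForm hA hX (fun x _ => x) W := by
  have := re_trace_mpow_mul_mpow hA hX 1 0 W
  simpa [mpow_one hA, mpow_zero hX] using this

lemma re_trace_conjTranspose_mul_self_mul (hA : A.IsHermitian) (hX : X.IsHermitian)
    (W : Matrix (Fin n) (Fin n) ℂ) :
    (Wᴴ * W * X).trace.re = spectralForm hA hX (fun _ y => y) W := by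
  have := re_trace_mpow_mul_mpow hA hX 0 1 W
  simpa [mpow_one hX, mpow_zero hA] using this

lemma spectralForm_mono (hA : A.PosDef) (hX : X.PosDef) {σ τ : ℝ → ℝ → ℝ}
    (h : ∀ x y, 0 < x → 0 < y → σ x y ≤ τ x y) (W : Matrix (Fin n) (Fin n) ℂ) :
    spectralForm hA.isHermitian hX.isHermitian σ W
      ≤ spectralForm hA.isHermitian hX.isHermitian τ W :=
  Finset.sum_le_sum fun i _ => Finset.sum_le_sum fun j _ =>
    mul_le_mul_of_nonneg_left (h _ _ (hA.eigenvalues_pos i) (hX.eigenvalues_pos j))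
      (Complex.normSq_nonneg _)

end SpectralForm

section LoewnerOrder

variable {n : ℕ} {A A₁ A₂ : Matrix (Fin n) (Fin n) ℂ} {l m : ℝ}

lemma re_trace_conjTranspose_mul_mul_superadditive (h : (A - (l • A₁ + m • A₂)).PosSemidef)
    (Y : Matrix (Fin n) (Fin n) ℂ) :
    l * (Yᴴ * A₁ * Y).trace.re + m * (Yᴴ * A₂ * Y).trace.re ≤ (Yᴴ * A * Y).trace.re := by
  have h1 := (Complex.le_def.1 (h.conjTranspose_mul_mul_same Y).trace_nonneg).1
  simp only [Matrix.mul_sub, Matrix.mul_add, Matrix.sub_mul, Matrix.add_mul, Matrix.mul_smul,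
    Matrix.smul_mul, Matrix.trace_sub, Matrix.trace_add, Matrix.trace_smul, Complex.sub_re,
    Complex.add_re, Complex.real_smul, Complex.re_ofReal_mul, Complex.zero_re] at h1
  linarith

lemma re_trace_conjTranspose_mul_self_mul_superadditive (h : (A - (l • A₁ + m • A₂)).PosSemidef)
    (Y : Matrix (Fin n) (Fin n) ℂ) :
    l * (Yᴴ * Y * A₁).trace.re + m * (Yᴴ * Y * A₂).trace.re ≤ (Yᴴ * Y * A).trace.re := by
  have h1 := re_trace_conjTranspose_mul_mul_superadditive h Yᴴ
  have key (B : Matrix (Fin n) (Fin n) ℂ) : (Yᴴᴴ * B * Yᴴ).trace = (Yᴴ * Y * B).trace := by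
    rw [Matrix.trace_mul_cycle, Matrix.conjTranspose_conjTranspose]
  simpa only [key] using h1

end LoewnerOrder

section Lieb

open MeasureTheory Set

variable {n : ℕ} {A A₁ A₂ X X₁ X₂ : Matrix (Fin n) (Fin n) ℂ} {l m : ℝ}

lemma normSq_mul_parallel_le {a x t : ℝ} (ha : 0 < a) (hx : 0 < x) (ht : 0 < t) (w y : ℂ) :
    Complex.normSq w * (a * x / (a + t * x))
      ≤ t⁻¹ * (Complex.normSq y * a) + Complex.normSq (w - y) * x := by
  have h0 : 0 < a + t * x := by positivity
  have h : t⁻¹ * (Complex.normSq y * a) + Complex.normSq (w - y) * x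
      - Complex.normSq w * (a * x / (a + t * x))
      = Complex.normSq (a * y - t * x * (w - y)) / (t * (a + t * x)) := by
    simp only [Complex.normSq_apply, Complex.sub_re, Complex.sub_im, Complex.mul_re,
      Complex.mul_im, Complex.ofReal_re, Complex.ofReal_im]
    field_simp
    ring
  have := div_nonneg (Complex.normSq_nonneg (a * y - t * x * (w - y)))
    (mul_pos ht h0).le
  linarith

lemma spectralForm_parallel_le (hA : A.PosDef) (hX : X.PosDef) {t : ℝ} (ht : 0 < t)
    (W Y : Matrix (Fin n) (Fin n) ℂ) :
    spectralForm hA.isHermitian hX.isHermitian (fun a x => a * x / (a + t * x)) W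
      ≤ t⁻¹ * (Yᴴ * A * Y).trace.re + ((W - Y)ᴴ * (W - Y) * X).trace.re := by
  rw [re_trace_mul_mul_self hA.isHermitian hX.isHermitian,
    re_trace_conjTranspose_mul_self_mul hA.isHermitian hX.isHermitian]
  simp only [spectralForm, Finset.mul_sum, ← Finset.sum_add_distrib, eigenCoord_sub,
    Matrix.sub_apply]
  exact Finset.sum_le_sum fun i _ => Finset.sum_le_sum fun j _ =>
    normSq_mul_parallel_le (hA.eigenvalues_pos i) (hX.eigenvalues_pos j) ht _ _

lemma exists_spectralForm_parallel_eq (hA : A.PosDef) (hX : X.PosDef) {t : ℝ} (ht : 0 < t)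
    (W : Matrix (Fin n) (Fin n) ℂ) : ∃ Y : Matrix (Fin n) (Fin n) ℂ,
    spectralForm hA.isHermitian hX.isHermitian (fun a x => a * x / (a + t * x)) W
      = t⁻¹ * (Yᴴ * A * Y).trace.re + ((W - Y)ᴴ * (W - Y) * X).trace.re := by
  obtain ⟨Y, hY⟩ := eigenCoord_surjective hA.isHermitian hX.isHermitian
    (Matrix.of fun i j => ((t * hX.isHermitian.eigenvalues j / (hA.isHermitian.eigenvalues i
      + t * hX.isHermitian.eigenvalues j) : ℝ) : ℂ)
        * eigenCoord hA.isHermitian hX.isHermitian W i j)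
  refine ⟨Y, ?_⟩
  rw [re_trace_mul_mul_self hA.isHermitian hX.isHermitian,
    re_trace_conjTranspose_mul_self_mul hA.isHermitian hX.isHermitian]
  simp only [spectralForm, Finset.mul_sum, ← Finset.sum_add_distrib, eigenCoord_sub,
    Matrix.sub_apply, hY, Matrix.of_apply]
  refine Finset.sum_congr rfl fun i _ => Finset.sum_congr rfl fun j _ => ?_
  have ha := hA.eigenvalues_pos i
  have hx := hX.eigenvalues_pos j
  have h0 : 0 < hA.isHermitian.eigenvalues i + t * hX.isHermitian.eigenvalues j := by positivity
  simp only [Complex.normSq_apply, Complex.sub_re, Complex.sub_im, Complex.mul_re,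
      Complex.mul_im, Complex.ofReal_re, Complex.ofReal_im]
  field_simp
  ring

lemma spectralForm_parallel_superadditive (hA : A.PosDef) (hA₁ : A₁.PosDef) (hA₂ : A₂.PosDef)
    (hX : X.PosDef) (hX₁ : X₁.PosDef) (hX₂ : X₂.PosDef) (hl : 0 ≤ l) (hm : 0 ≤ m)
    (hAle : (A - (l • A₁ + m • A₂)).PosSemidef) (hXle : (X - (l • X₁ + m • X₂)).PosSemidef)
    {t : ℝ} (ht : 0 < t) (W : Matrix (Fin n) (Fin n) ℂ) :
    l * spectralForm hA₁.isHermitian hX₁.isHermitian (fun a x => a * x / (a + t * x)) W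
      + m * spectralForm hA₂.isHermitian hX₂.isHermitian (fun a x => a * x / (a + t * x)) W
      ≤ spectralForm hA.isHermitian hX.isHermitian (fun a x => a * x / (a + t * x)) W := by
  obtain ⟨Y, hY⟩ := exists_spectralForm_parallel_eq hA hX ht W
  have h1 := mul_le_mul_of_nonneg_left (spectralForm_parallel_le hA₁ hX₁ ht W Y) hl
  have h2 := mul_le_mul_of_nonneg_left (spectralForm_parallel_le hA₂ hX₂ ht W Y) hm
  have h3 := mul_le_mul_of_nonneg_left
    (re_trace_conjTranspose_mul_mul_superadditive hAle Y) (inv_pos.2 ht).le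
  have h4 := re_trace_conjTranspose_mul_self_mul_superadditive hXle (W - Y)
  rw [hY]
  linarith

lemma rpow_mul_parallel_eq {p a x t : ℝ} (hp : p ∈ Ioo 0 1) (ha : 0 < a) (hx : 0 < x)
    (ht : 0 < t) :
    t ^ (p - 1) * (a * x / (a + t * x)) = Real.rpowIntegrand₀₁ p t (a / x) * x := by
  rw [Real.rpowIntegrand₀₁_eq_pow_div hp ht.le (by positivity)]
  field_simp
  ring

lemma integrableOn_rpow_mul_parallel {p a x : ℝ} (hp : p ∈ Ioo 0 1) (ha : 0 < a) (hx : 0 < x) :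
    IntegrableOn (fun t => t ^ (p - 1) * (a * x / (a + t * x))) (Ioi 0) := by
  refine IntegrableOn.congr_fun (f := fun t => Real.rpowIntegrand₀₁ p t (a / x) * x) ?_
    (fun t ht => (rpow_mul_parallel_eq hp ha hx ht).symm) measurableSet_Ioi
  exact (Real.integrableOn_rpowIntegrand₀₁_Ioi hp (div_pos ha hx).le).mul_const x

lemma integral_rpow_mul_parallel {p a x : ℝ} (hp : p ∈ Ioo 0 1) (ha : 0 < a) (hx : 0 < x) :
    ∫ t in Ioi 0, t ^ (p - 1) * (a * x / (a + t * x))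
      = (∫ t in Ioi 0, Real.rpowIntegrand₀₁ p t 1) * (a ^ p * x ^ (1 - p)) := by
  rw [setIntegral_congr_fun measurableSet_Ioi (fun t ht => rpow_mul_parallel_eq hp ha hx ht),
    integral_mul_const, Real.integral_rpowIntegrand₀₁_eq_rpow_mul_const hp (div_pos ha hx).le,
    Real.div_rpow ha.le hx.le, Real.rpow_sub hx, Real.rpow_one]
  field_simp

lemma rpow_mul_spectralForm_parallel (hA : A.PosDef) (hX : X.PosDef) (p t : ℝ)
    (W : Matrix (Fin n) (Fin n) ℂ) :
    t ^ (p - 1) * spectralForm hA.isHermitian hX.isHermitian (fun a x => a * x / (a + t * x)) W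
      = ∑ i, ∑ j, Complex.normSq (eigenCoord hA.isHermitian hX.isHermitian W i j) *
        (t ^ (p - 1) * (hA.isHermitian.eigenvalues i * hX.isHermitian.eigenvalues j /
          (hA.isHermitian.eigenvalues i + t * hX.isHermitian.eigenvalues j))) := by
  simp only [spectralForm, Finset.mul_sum]
  exact Finset.sum_congr rfl fun i _ => Finset.sum_congr rfl fun j _ => by ring

lemma integrableOn_spectralForm_parallel (hA : A.PosDef) (hX : X.PosDef) {p : ℝ}
    (hp : p ∈ Ioo 0 1) (W : Matrix (Fin n) (Fin n) ℂ) :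
    IntegrableOn (fun t => t ^ (p - 1) * spectralForm hA.isHermitian hX.isHermitian
      (fun a x => a * x / (a + t * x)) W) (Ioi 0) := by
  simp only [rpow_mul_spectralForm_parallel hA hX]
  exact integrable_finsetSum _ fun i _ => integrable_finsetSum _ fun j _ =>
    (integrableOn_rpow_mul_parallel hp (hA.eigenvalues_pos i) (hX.eigenvalues_pos j)).const_mul _

lemma integral_spectralForm_parallel (hA : A.PosDef) (hX : X.PosDef) {p : ℝ}
    (hp : p ∈ Ioo 0 1) (W : Matrix (Fin n) (Fin n) ℂ) :
    ∫ t in Ioi 0, t ^ (p - 1) * spectralForm hA.isHermitian hX.isHermitian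
      (fun a x => a * x / (a + t * x)) W
    = (∫ t in Ioi 0, Real.rpowIntegrand₀₁ p t 1) *
      spectralForm hA.isHermitian hX.isHermitian (fun a x => a ^ p * x ^ (1 - p)) W := by
  have hint (i j) := (integrableOn_rpow_mul_parallel hp (hA.eigenvalues_pos i)
    (hX.eigenvalues_pos j)).const_mul
      (Complex.normSq (eigenCoord hA.isHermitian hX.isHermitian W i j))
  simp only [rpow_mul_spectralForm_parallel hA hX]
  rw [integral_finsetSum _ fun i _ => integrable_finsetSum _ fun j _ => hint i j]
  simp only [spectralForm, Finset.mul_sum]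
  refine Finset.sum_congr rfl fun i _ => ?_
  rw [integral_finsetSum _ fun j _ => hint i j]
  refine Finset.sum_congr rfl fun j _ => ?_
  rw [integral_const_mul,
    integral_rpow_mul_parallel hp (hA.eigenvalues_pos i) (hX.eigenvalues_pos j)]
  ring

/-- Lieb's concavity theorem for exponents summing to one, combined with monotonicity. -/
lemma re_trace_mpow_mul_mpow_superadditive_of_add_eq_one (hA : A.PosDef) (hA₁ : A₁.PosDef)
    (hA₂ : A₂.PosDef) (hX : X.PosDef) (hX₁ : X₁.PosDef) (hX₂ : X₂.PosDef) (hl : 0 ≤ l)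
    (hm : 0 ≤ m) (hAle : (A - (l • A₁ + m • A₂)).PosSemidef)
    (hXle : (X - (l • X₁ + m • X₂)).PosSemidef) {p : ℝ} (hp : p ∈ Icc 0 1)
    (W : Matrix (Fin n) (Fin n) ℂ) :
    l * (Wᴴ * mpow A₁ p * W * mpow X₁ (1 - p)).trace.re
      + m * (Wᴴ * mpow A₂ p * W * mpow X₂ (1 - p)).trace.re
      ≤ (Wᴴ * mpow A p * W * mpow X (1 - p)).trace.re := by
  rcases hp.1.eq_or_lt with rfl | hp0
  · simpa [mpow_zero, mpow_one, PosDef.isHermitian, *] using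
      re_trace_conjTranspose_mul_self_mul_superadditive hXle W
  rcases hp.2.eq_or_lt with rfl | hp1
  · simpa [mpow_zero, mpow_one, PosDef.isHermitian, *] using
      re_trace_conjTranspose_mul_mul_superadditive hAle W
  have hp' : p ∈ Ioo 0 1 := ⟨hp0, hp1⟩
  simp only [re_trace_mpow_mul_mpow, PosDef.isHermitian, *]
  have hC := Real.integral_rpowIntegrand₀₁_one_pos hp'
  refine le_of_mul_le_mul_left ?_ hC
  rw [← integral_spectralForm_parallel hA hX hp' W, mul_add, mul_left_comm, mul_left_comm _ m,
    ← integral_spectralForm_parallel hA₁ hX₁ hp' W, ← integral_spectralForm_parallel hA₂ hX₂ hp' W,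
    ← integral_const_mul, ← integral_const_mul, ← integral_add
      ((integrableOn_spectralForm_parallel hA₁ hX₁ hp' W).const_mul l)
      ((integrableOn_spectralForm_parallel hA₂ hX₂ hp' W).const_mul m)]
  refine setIntegral_mono_on
    (((integrableOn_spectralForm_parallel hA₁ hX₁ hp' W).const_mul l).add
      ((integrableOn_spectralForm_parallel hA₂ hX₂ hp' W).const_mul m))
    (integrableOn_spectralForm_parallel hA hX hp' W) measurableSet_Ioi fun t ht => ?_
  have := mul_le_mul_of_nonneg_left (spectralForm_parallel_superadditive hA hA₁ hA₂ hX hX₁ hX₂ hl hm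
    hAle hXle ht W) (Real.rpow_nonneg (le_of_lt ht) (p - 1))
  linarith

lemma posSemidef_of_forall_re_trace_nonneg {D : Matrix (Fin n) (Fin n) ℂ} (hD : D.IsHermitian)
    (h : ∀ W : Matrix (Fin n) (Fin n) ℂ, 0 ≤ (Wᴴ * D * W).trace.re) : D.PosSemidef := by
  rw [hD.posSemidef_iff_eigenvalues_nonneg]
  intro i
  have h1 := h ((hD.eigenvectorUnitary : Matrix (Fin n) (Fin n) ℂ) * Matrix.single i i 1)
  have h2 : (hD.eigenvectorUnitary : Matrix (Fin n) (Fin n) ℂ)ᴴ * D *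
      (hD.eigenvectorUnitary : Matrix (Fin n) (Fin n) ℂ)
      = Matrix.diagonal (RCLike.ofReal ∘ hD.eigenvalues) := by
    have := hD.conjStarAlgAut_star_eigenvectorUnitary
    rwa [Unitary.conjStarAlgAut_star_apply] at this
  have h3 : ((hD.eigenvectorUnitary : Matrix (Fin n) (Fin n) ℂ) * Matrix.single i i 1)ᴴ * D *
      ((hD.eigenvectorUnitary : Matrix (Fin n) (Fin n) ℂ) * Matrix.single i i 1)
      = Matrix.single i i 1 * ((hD.eigenvectorUnitary : Matrix (Fin n) (Fin n) ℂ)ᴴ * D *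
        (hD.eigenvectorUnitary : Matrix (Fin n) (Fin n) ℂ)) * Matrix.single i i 1 := by
    simp [Matrix.conjTranspose_mul, Matrix.mul_assoc, Matrix.conjTranspose_single]
  rw [h3, h2] at h1
  simpa using h1

/-- The operator concavity of `x ↦ x ^ r` for `0 ≤ r ≤ 1`. -/
lemma mpow_concave (hX : X.PosDef) (hX₁ : X₁.PosDef) (hX₂ : X₂.PosDef) (hl : 0 ≤ l) (hm : 0 ≤ m)
    (hlm : l + m = 1) (hXeq : X = l • X₁ + m • X₂) {r : ℝ} (hr : r ∈ Icc 0 1) :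
    (mpow X r - (l • mpow X₁ r + m • mpow X₂ r)).PosSemidef := by
  have hH : (mpow X r - (l • mpow X₁ r + m • mpow X₂ r)).IsHermitian :=
    (mpow_isHermitian_s11 hX.isHermitian r).sub
      (((mpow_isHermitian_s11 hX₁.isHermitian r).smul (IsSelfAdjoint.all l)).add
        ((mpow_isHermitian_s11 hX₂.isHermitian r).smul (IsSelfAdjoint.all m)))
  refine posSemidef_of_forall_re_trace_nonneg hH fun W => ?_
  have h1 : ((1 : Matrix (Fin n) (Fin n) ℂ) - (l • 1 + m • 1)).PosSemidef := by
    rw [← add_smul, hlm, one_smul, sub_self]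
    exact Matrix.PosSemidef.zero
  have h2 : (X - (l • X₁ + m • X₂)).PosSemidef := by
    rw [hXeq, sub_self]
    exact Matrix.PosSemidef.zero
  have h3 := re_trace_mpow_mul_mpow_superadditive_of_add_eq_one hX hX₁ hX₂ Matrix.PosDef.one
    Matrix.PosDef.one Matrix.PosDef.one hl hm h2 h1 hr W
  simp only [one_mpow, Matrix.mul_one] at h3
  simp only [Matrix.mul_sub, Matrix.mul_add, Matrix.sub_mul, Matrix.add_mul, Matrix.mul_smul,
    Matrix.smul_mul, Matrix.trace_sub, Matrix.trace_add, Matrix.trace_smul, Complex.sub_re,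
    Complex.add_re, Complex.real_smul, Complex.re_ofReal_mul]
  linarith

/-- Lieb's concavity theorem. -/
lemma re_trace_mpow_mul_mpow_concave (hA : A.PosDef) (hA₁ : A₁.PosDef)
    (hA₂ : A₂.PosDef) (hX : X.PosDef) (hX₁ : X₁.PosDef) (hX₂ : X₂.PosDef) (hl : 0 ≤ l)
    (hm : 0 ≤ m) (hlm : l + m = 1) (hAeq : A = l • A₁ + m • A₂) (hXeq : X = l • X₁ + m • X₂)
    {a b : ℝ} (ha : 0 ≤ a) (hb : 0 ≤ b) (hab : a + b ≤ 1) (W : Matrix (Fin n) (Fin n) ℂ) :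
    l * (Wᴴ * mpow A₁ a * W * mpow X₁ b).trace.re
      + m * (Wᴴ * mpow A₂ a * W * mpow X₂ b).trace.re
      ≤ (Wᴴ * mpow A a * W * mpow X b).trace.re := by
  have hb' : b / (1 - a) * (1 - a) = b := by
    rcases eq_or_ne (1 - a) 0 with h | h
    · rw [h]
      linarith
    · exact div_mul_cancel₀ b h
  have hr : b / (1 - a) ∈ Icc (0 : ℝ) 1 :=
    ⟨div_nonneg hb (by linarith), div_le_one_of_le₀ (by linarith) (by linarith)⟩
  have hAle : (A - (l • A₁ + m • A₂)).PosSemidef := by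
    rw [hAeq, sub_self]
    exact Matrix.PosSemidef.zero
  have h := re_trace_mpow_mul_mpow_superadditive_of_add_eq_one hA hA₁ hA₂
    (mpow_posDef hX _) (mpow_posDef hX₁ _) (mpow_posDef hX₂ _) hl hm hAle
    (mpow_concave hX hX₁ hX₂ hl hm hlm hXeq hr) ⟨ha, by linarith⟩ W
  simpa only [mpow_mpow, hX, hX₁, hX₂, hb'] using h

lemma two_mul_re_trace_sub_le (hA : A.PosDef) (hX : X.PosDef) (a b : ℝ)
    (K W : Matrix (Fin n) (Fin n) ℂ) :
    2 * (Wᴴ * K).trace.re - (Wᴴ * mpow A a * W * mpow X b).trace.re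
      ≤ (Kᴴ * mpow A (-a) * K * mpow X (-b)).trace.re := by
  have hAi : mpow A a * mpow A (-a) = 1 := by
    rw [mpow_mul_mpow hA, add_neg_cancel, mpow_zero hA.isHermitian]
  have hAi' : mpow A (-a) * mpow A a = 1 := by
    rw [mpow_mul_mpow hA, neg_add_cancel, mpow_zero hA.isHermitian]
  have hXi : mpow X b * mpow X (-b) = 1 := by
    rw [mpow_mul_mpow hX, add_neg_cancel, mpow_zero hX.isHermitian]
  have hXi' : mpow X (-b) * mpow X b = 1 := by
    rw [mpow_mul_mpow hX, neg_add_cancel, mpow_zero hX.isHermitian]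
  have hAH : (mpow A (-a))ᴴ = mpow A (-a) := mpow_isHermitian_s11 hA.isHermitian _
  have hXH : (mpow X (-b))ᴴ = mpow X (-b) := mpow_isHermitian_s11 hX.isHermitian _
  set E := mpow A (-a) * K * mpow X (-b) with hE
  have hEK : mpow A a * E * mpow X b = K := by
    simp only [hE, ← Matrix.mul_assoc, hAi, Matrix.one_mul]
    rw [Matrix.mul_assoc, hXi', Matrix.mul_one]
  have h0 : 0 ≤ ((W - E)ᴴ * mpow A a * (W - E) * mpow X b).trace.re := by
    rw [re_trace_mpow_mul_mpow hA.isHermitian hX.isHermitian]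
    exact Finset.sum_nonneg fun i _ => Finset.sum_nonneg fun j _ =>
      mul_nonneg (Complex.normSq_nonneg _) (mul_nonneg
        (Real.rpow_nonneg (hA.eigenvalues_pos i).le _)
        (Real.rpow_nonneg (hX.eigenvalues_pos j).le _))
  have h1 : (Wᴴ * mpow A a * E * mpow X b).trace = (Wᴴ * K).trace := by
    conv_rhs => rw [← hEK]
    simp only [Matrix.mul_assoc]
  have h2 (V : Matrix (Fin n) (Fin n) ℂ) :
      (Eᴴ * mpow A a * V * mpow X b).trace = (Kᴴ * V).trace := by
    have : Eᴴ * mpow A a * V * mpow X b = mpow X (-b) * (Kᴴ * V) * mpow X b := by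
      simp only [hE, Matrix.conjTranspose_mul, hAH, hXH, Matrix.mul_assoc]
      rw [← Matrix.mul_assoc (mpow A (-a)) (mpow A a), hAi', Matrix.one_mul]
    rw [this, Matrix.trace_mul_cycle, hXi, Matrix.one_mul]
  have h3 : (Kᴴ * E).trace = (Kᴴ * mpow A (-a) * K * mpow X (-b)).trace := by
    simp only [hE, Matrix.mul_assoc]
  have h4 : (Kᴴ * W).trace.re = (Wᴴ * K).trace.re := by
    rw [← Complex.conj_re, ← Complex.star_def, ← Matrix.trace_conjTranspose]
    simp [Matrix.conjTranspose_mul]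
  simp only [Matrix.conjTranspose_sub, Matrix.sub_mul, Matrix.mul_sub, Matrix.trace_sub, h1, h2,
    h3, Complex.sub_re, h4] at h0
  linarith

lemma two_mul_re_trace_sub_eq (hA : A.PosDef) (hX : X.PosDef) (a b : ℝ)
    (K : Matrix (Fin n) (Fin n) ℂ) : ∃ W : Matrix (Fin n) (Fin n) ℂ,
    2 * (Wᴴ * K).trace.re - (Wᴴ * mpow A a * W * mpow X b).trace.re
      = (Kᴴ * mpow A (-a) * K * mpow X (-b)).trace.re := by
  refine ⟨mpow A (-a) * K * mpow X (-b), ?_⟩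
  have hAH : (mpow A (-a))ᴴ = mpow A (-a) := mpow_isHermitian_s11 hA.isHermitian _
  have hXH : (mpow X (-b))ᴴ = mpow X (-b) := mpow_isHermitian_s11 hX.isHermitian _
  have hAi : mpow A a * mpow A (-a) = 1 := by
    rw [mpow_mul_mpow hA, add_neg_cancel, mpow_zero hA.isHermitian]
  have hXi' : mpow X (-b) * mpow X b = 1 := by
    rw [mpow_mul_mpow hX, neg_add_cancel, mpow_zero hX.isHermitian]
  have h1 : (mpow A (-a) * K * mpow X (-b))ᴴ * mpow A a * (mpow A (-a) * K * mpow X (-b)) *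
      mpow X b = mpow X (-b) * (Kᴴ * mpow A (-a) * K) := by
    have : mpow A a * (mpow A (-a) * K * mpow X (-b)) * mpow X b = K := by
      simp only [← Matrix.mul_assoc, hAi, Matrix.one_mul]
      rw [Matrix.mul_assoc, hXi', Matrix.mul_one]
    rw [Matrix.mul_assoc, Matrix.mul_assoc, ← Matrix.mul_assoc (mpow A a), this]
    simp only [Matrix.conjTranspose_mul, hAH, hXH, Matrix.mul_assoc]
  have h2 : ((mpow A (-a) * K * mpow X (-b))ᴴ * K).trace
      = (Kᴴ * mpow A (-a) * K * mpow X (-b)).trace := by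
    rw [Matrix.trace_mul_comm _ (mpow X (-b))]
    simp only [Matrix.conjTranspose_mul, hAH, hXH, Matrix.mul_assoc]
  rw [h1, h2, Matrix.trace_mul_comm (mpow X (-b))]
  ring

/-- Joint convexity of `(K, A, X) ↦ Tr[K* A^{-a} K X^{-b}]`. -/
lemma re_trace_mpow_neg_convex (hA : A.PosDef) (hA₁ : A₁.PosDef)
    (hA₂ : A₂.PosDef) (hX : X.PosDef) (hX₁ : X₁.PosDef) (hX₂ : X₂.PosDef) (hl : 0 ≤ l)
    (hm : 0 ≤ m) (hlm : l + m = 1) (hAeq : A = l • A₁ + m • A₂) (hXeq : X = l • X₁ + m • X₂)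
    {K K₁ K₂ : Matrix (Fin n) (Fin n) ℂ} (hK : K = l • K₁ + m • K₂)
    {a b : ℝ} (ha : 0 ≤ a) (hb : 0 ≤ b) (hab : a + b ≤ 1) :
    (Kᴴ * mpow A (-a) * K * mpow X (-b)).trace.re
      ≤ l * (K₁ᴴ * mpow A₁ (-a) * K₁ * mpow X₁ (-b)).trace.re
        + m * (K₂ᴴ * mpow A₂ (-a) * K₂ * mpow X₂ (-b)).trace.re := by
  obtain ⟨W, hW⟩ := two_mul_re_trace_sub_eq hA hX a b K
  have h1 := mul_le_mul_of_nonneg_left (two_mul_re_trace_sub_le hA₁ hX₁ a b K₁ W) hl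
  have h2 := mul_le_mul_of_nonneg_left (two_mul_re_trace_sub_le hA₂ hX₂ a b K₂ W) hm
  have h3 := re_trace_mpow_mul_mpow_concave hA hA₁ hA₂ hX hX₁ hX₂ hl hm hlm hAeq hXeq ha hb hab W
  have h4 : (Wᴴ * K).trace.re = l * (Wᴴ * K₁).trace.re + m * (Wᴴ * K₂).trace.re := by
    simp [hK, Matrix.mul_add, Matrix.trace_add, Matrix.trace_smul]
  rw [← hW, h4]
  linarith

end Lieb

section TraceYoung

variable {n : ℕ} {X Y : Matrix (Fin n) (Fin n) ℂ}

lemma spectralForm_linear (hY : Y.IsHermitian) (hX : X.IsHermitian) (c d : ℝ)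
    (σ τ : ℝ → ℝ → ℝ) (W : Matrix (Fin n) (Fin n) ℂ) :
    spectralForm hY hX (fun y x => c * σ y x + d * τ y x) W
      = c * spectralForm hY hX σ W + d * spectralForm hY hX τ W := by
  simp only [spectralForm, Finset.mul_sum, ← Finset.sum_add_distrib]
  exact Finset.sum_congr rfl fun i _ => Finset.sum_congr rfl fun j _ => by ring

lemma re_trace_mpow_mul_mpow_eq (hY : Y.IsHermitian) (hX : X.IsHermitian) (r s : ℝ) :
    (mpow Y r * mpow X s).trace.re = spectralForm hY hX (fun y x => y ^ r * x ^ s) 1 := by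
  rw [← re_trace_mpow_mul_mpow]
  simp

lemma re_trace_mpow_le_of_le_one (hY : Y.PosDef) (hX : X.PosDef) {s : ℝ} (hs₀ : 0 < s)
    (hs₁ : s ≤ 1) :
    (mpow Y s).trace.re ≤ s * (Y * mpow X (1 - 1 / s)).trace.re + (1 - s) * X.trace.re := by
  have hYH := hY.isHermitian
  have hXH := hX.isHermitian
  have e1 := re_trace_mpow_mul_mpow_eq hYH hXH s 0
  have e2 := re_trace_mpow_mul_mpow_eq hYH hXH 1 (1 - 1 / s)
  have e3 := re_trace_mpow_mul_mpow_eq hYH hXH 0 1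
  rw [mpow_zero hXH, Matrix.mul_one] at e1
  rw [mpow_one hYH] at e2
  rw [mpow_zero hYH, mpow_one hXH, Matrix.one_mul] at e3
  rw [e1, e2, e3, ← spectralForm_linear]
  refine spectralForm_mono hY hX (fun y x hy hx => ?_) 1
  have h := Real.geom_mean_le_arith_mean2_weighted hs₀.le (sub_nonneg.2 hs₁)
    (mul_pos hy (Real.rpow_pos_of_pos hx (1 - 1 / s))).le hx.le (by ring)
  rw [Real.mul_rpow hy.le (Real.rpow_pos_of_pos hx _).le, ← Real.rpow_mul hx.le, mul_assoc,
    ← Real.rpow_add hx, show (1 - 1 / s) * s + (1 - s) = 0 by field_simp; ring] at h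
  simpa using h

lemma re_trace_mpow_tangent_le (hY : Y.PosDef) (hX : X.PosDef) {s : ℝ} (hs : 1 ≤ s) :
    s * (Y * mpow X (s - 1)).trace.re ≤ (mpow Y s).trace.re + (s - 1) * (mpow X s).trace.re := by
  have hYH := hY.isHermitian
  have hXH := hX.isHermitian
  have e1 := re_trace_mpow_mul_mpow_eq hYH hXH s 0
  have e2 := re_trace_mpow_mul_mpow_eq hYH hXH 1 (s - 1)
  have e3 := re_trace_mpow_mul_mpow_eq hYH hXH 0 s
  rw [mpow_zero hXH, Matrix.mul_one] at e1
  rw [mpow_one hYH] at e2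
  rw [mpow_zero hYH, Matrix.one_mul] at e3
  have hs₀ : 0 < s := by linarith
  suffices (Y * mpow X (s - 1)).trace.re
      ≤ 1 / s * (mpow Y s).trace.re + (1 - 1 / s) * (mpow X s).trace.re by
    have h := mul_le_mul_of_nonneg_left this hs₀.le
    refine h.trans_eq ?_
    field_simp
  rw [e1, e2, e3, ← spectralForm_linear]
  refine spectralForm_mono hY hX (fun y x hy hx => ?_) 1
  have h := Real.geom_mean_le_arith_mean2_weighted (one_div_pos.2 hs₀).le
    (sub_nonneg.2 ((div_le_one hs₀).2 hs)) (Real.rpow_pos_of_pos hy s).le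
    (Real.rpow_pos_of_pos hx s).le (by ring)
  rw [← Real.rpow_mul hy.le, ← Real.rpow_mul hx.le, show s * (1 / s) = 1 by field_simp,
    show s * (1 - 1 / s) = s - 1 by field_simp] at h
  simpa using h

end TraceYoung

section JointConvexity

variable {n : ℕ} {A B A₁ A₂ B₁ B₂ : Matrix (Fin n) (Fin n) ℂ} {l m : ℝ}

lemma Matrix.PosDef.smul_add_smul (hA₁ : A₁.PosDef) (hA₂ : A₂.PosDef) (hl : 0 ≤ l) (hm : 0 ≤ m)
    (hlm : l + m = 1) : (l • A₁ + m • A₂).PosDef := by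
  rcases hl.eq_or_lt with rfl | hl
  · obtain rfl : m = 1 := by linarith
    simpa using hA₂
  rcases hm.eq_or_lt with rfl | hm
  · obtain rfl : l = 1 := by linarith
    simpa using hA₁
  exact (hA₁.smul hl).add (hA₂.smul hm)

lemma mul_mpow_mul_posDef (hA : A.PosDef) (hB : B.PosDef) (q : ℝ) :
    (B * mpow A q * B).PosDef := by
  have := (mpow_posDef hA q).mul_mul_conjTranspose_same (B := B)
    (Matrix.vecMul_injective_of_isUnit hB.isUnit)
  rwa [hB.isHermitian.eq] at this

lemma Phi_two_eq (hA : A.PosDef) (hB : B.PosDef) (q s : ℝ) :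
    Phi 2 q s A B = (mpow (B * mpow A q * B) s).trace.re := by
  have h1 : mpow A (q / 2) * mpow B 2 * mpow A (q / 2)
      = (mpow A (q / 2) * B) * (B * mpow A (q / 2)) := by
    rw [mpow_two hB]
    simp only [Matrix.mul_assoc]
  have h2 : B * mpow A q * B = (B * mpow A (q / 2)) * (mpow A (q / 2) * B) := by
    rw [← add_halves q, ← mpow_mul_mpow hA, add_halves]
    simp only [Matrix.mul_assoc]
  have h3 : ((mpow A (q / 2) * B) * (B * mpow A (q / 2))).IsHermitian := by
    have := Matrix.isHermitian_mul_conjTranspose_self (mpow A (q / 2) * B)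
    rwa [Matrix.conjTranspose_mul, hB.isHermitian.eq,
      (mpow_isHermitian_s11 hA.isHermitian (q / 2)).eq] at this
  rw [Phi, h1, h2, trace_mpow_mul_comm h3 (h2 ▸ (mul_mpow_mul_posDef hA hB q).isHermitian)]

lemma re_trace_mpow_convex_of_le_one (hA₁ : A₁.PosDef) (hA₂ : A₂.PosDef) (hB₁ : B₁.PosDef)
    (hB₂ : B₂.PosDef) (hl : 0 ≤ l) (hm : 0 ≤ m) (hlm : l + m = 1)
    (hA : A = l • A₁ + m • A₂) (hB : B = l • B₁ + m • B₂) {a s : ℝ} (ha : 0 ≤ a)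
    (hs₀ : 0 < s) (hs₁ : s ≤ 1) (has : a + (1 / s - 1) ≤ 1) :
    (mpow (B * mpow A (-a) * B) s).trace.re ≤ l * (mpow (B₁ * mpow A₁ (-a) * B₁) s).trace.re
      + m * (mpow (B₂ * mpow A₂ (-a) * B₂) s).trace.re := by
  have hAp : A.PosDef := hA ▸ hA₁.smul_add_smul hA₂ hl hm hlm
  have hBp : B.PosDef := hB ▸ hB₁.smul_add_smul hB₂ hl hm hlm
  have hY₁ := mul_mpow_mul_posDef hA₁ hB₁ (-a)
  have hY₂ := mul_mpow_mul_posDef hA₂ hB₂ (-a)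
  have hX₁ := mpow_posDef hY₁ s
  have hX₂ := mpow_posDef hY₂ s
  have hX := hX₁.smul_add_smul hX₂ hl hm hlm
  have h1 := re_trace_mpow_le_of_le_one (mul_mpow_mul_posDef hAp hBp (-a)) hX hs₀ hs₁
  have hb : 0 ≤ 1 / s - 1 := sub_nonneg.2 ((one_le_div hs₀).2 hs₁)
  have h2 := re_trace_mpow_neg_convex hAp hA₁ hA₂ hX hX₁ hX₂ hl hm hlm hA rfl hB ha hb has
  rw [hBp.isHermitian.eq, hB₁.isHermitian.eq, hB₂.isHermitian.eq, neg_sub] at h2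
  have key {Y : Matrix (Fin n) (Fin n) ℂ} (hY : Y.PosDef) :
      (Y * mpow (mpow Y s) (1 - 1 / s)).trace = (mpow Y s).trace := by
    rw [mpow_mpow hY]
    nth_rw 1 [← mpow_one hY.isHermitian]
    rw [mpow_mul_mpow hY]
    congr 2
    field_simp
    ring
  rw [key hY₁, key hY₂] at h2
  simp only [Matrix.trace_add, Matrix.trace_smul, Complex.add_re, Complex.real_smul,
    Complex.re_ofReal_mul] at h1
  have h3 := mul_le_mul_of_nonneg_left h2 hs₀.le
  linarith

lemma re_trace_mpow_convex_of_one_le (hA₁ : A₁.PosDef) (hA₂ : A₂.PosDef) (hB₁ : B₁.PosDef)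
    (hB₂ : B₂.PosDef) (hl : 0 ≤ l) (hm : 0 ≤ m) (hlm : l + m = 1)
    (hA : A = l • A₁ + m • A₂) (hB : B = l • B₁ + m • B₂) {a s : ℝ} (ha₀ : 0 ≤ a) (ha₁ : a ≤ 1)
    (hs : 1 ≤ s) :
    (mpow (B * mpow A (-a) * B) s).trace.re ≤ l * (mpow (B₁ * mpow A₁ (-a) * B₁) s).trace.re
      + m * (mpow (B₂ * mpow A₂ (-a) * B₂) s).trace.re := by
  have hAp : A.PosDef := hA ▸ hA₁.smul_add_smul hA₂ hl hm hlm
  have hBp : B.PosDef := hB ▸ hB₁.smul_add_smul hB₂ hl hm hlm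
  have hY := mul_mpow_mul_posDef hAp hBp (-a)
  set Y := B * mpow A (-a) * B with hYdef
  have h1 := mul_le_mul_of_nonneg_left
    (re_trace_mpow_tangent_le (mul_mpow_mul_posDef hA₁ hB₁ (-a)) hY hs) hl
  have h2 := mul_le_mul_of_nonneg_left
    (re_trace_mpow_tangent_le (mul_mpow_mul_posDef hA₂ hB₂ (-a)) hY hs) hm
  set Z := mpow Y ((s - 1) / 2) with hZ
  have hZH : Zᴴ = Z := mpow_isHermitian_s11 hY.isHermitian _
  have hZZ : Z * Z = mpow Y (s - 1) := by rw [hZ, mpow_mul_mpow hY, add_halves]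
  have hK : B * Z = l • (B₁ * Z) + m • (B₂ * Z) := by
    simp [hB, Matrix.add_mul]
  have hone : (1 : Matrix (Fin n) (Fin n) ℂ) = l • 1 + m • 1 := by
    rw [← add_smul, hlm, one_smul]
  have h3 := re_trace_mpow_neg_convex hAp hA₁ hA₂ Matrix.PosDef.one Matrix.PosDef.one
    Matrix.PosDef.one hl hm hlm hA hone hK ha₀ le_rfl (by linarith)
  have key {C D : Matrix (Fin n) (Fin n) ℂ} (hD : D.PosDef) :
      ((D * Z)ᴴ * mpow C (-a) * (D * Z) * mpow 1 (-0)).trace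
        = (D * mpow C (-a) * D * mpow Y (s - 1)).trace := by
    rw [one_mpow, Matrix.mul_one, Matrix.conjTranspose_mul, hZH, hD.isHermitian.eq, ← hZZ,
      Matrix.mul_assoc, Matrix.mul_assoc, Matrix.trace_mul_comm]
    simp only [Matrix.mul_assoc]
  rw [key hBp, key hB₁, key hB₂, ← hYdef] at h3
  have h4 : (Y * mpow Y (s - 1)).trace = (mpow Y s).trace := by
    nth_rw 1 [← mpow_one hY.isHermitian]
    rw [mpow_mul_mpow hY, add_sub_cancel]
  rw [h4] at h3
  have h5 := mul_le_mul_of_nonneg_left h3 (by linarith : 0 ≤ s)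
  have h6 : l * ((s - 1) * (mpow Y s).trace.re) + m * ((s - 1) * (mpow Y s).trace.re)
      = (s - 1) * (mpow Y s).trace.re := by rw [← add_mul, hlm, one_mul]
  linarith

end JointConvexity

/-- Theorem 4.2: for `q ∈ [−1,0)` and `s ≥ 1/(2+q)`, `Φ_{2,q,s}` is jointly convex. -/
theorem phi_jointly_convex_p_two (q s : ℝ) (hq₁ : -1 ≤ q) (hq₂ : q < 0)
    (hs : 1 / (2 + q) ≤ s) (n : ℕ) :
    JointlyConvex (Phi (n := n) 2 q s) := by
  intro A₁ A₂ B₁ B₂ hA₁ hA₂ hB₁ hB₂ t ht₀ ht₁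
  have hm : 0 ≤ 1 - t := sub_nonneg.2 ht₁
  have hlm : t + (1 - t) = 1 := add_sub_cancel t 1
  rw [Phi_two_eq (hA₁.smul_add_smul hA₂ ht₀ hm hlm) (hB₁.smul_add_smul hB₂ ht₀ hm hlm),
    Phi_two_eq hA₁ hB₁, Phi_two_eq hA₂ hB₂, ← neg_neg q]
  rcases le_total s 1 with hs₁ | hs₁
  · have hs₀ : 0 < s := lt_of_lt_of_le (one_div_pos.2 (by linarith)) hs
    have h : 1 / s ≤ 2 + q := (one_div_le (by linarith) hs₀).1 hs
    exact re_trace_mpow_convex_of_le_one hA₁ hA₂ hB₁ hB₂ ht₀ hm hlm rfl rfl (by linarith) hs₀ hs₁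
      (by linarith)
  · exact re_trace_mpow_convex_of_one_le hA₁ hA₂ hB₁ hB₂ ht₀ hm hlm rfl rfl (by linarith)
      (by linarith) hs₁
end
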